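/- For every T > 0, M ≥ 1, ε ∈ (0,1] and every real n ≥ 8, there exists a constant C > 0, depending only on M, ε, T and n, such that every smooth solution (v,u,θ,q) of the radiation hydrodynamics system on [0,T] with (M,ε)-bounded initial data satisfies, for all t ∈ [0,T]: ‖u_t(t,·)‖² + ∫₀ᵗ ∫_𝕋 u_{xt}(s,x)²/v(s,x) dx ds ≤ ℨ(t)^{𝔘ᶻ₁₁(n,β)} + C(1 + 𝔛(t) + 𝔜(t) + 𝔜(t)^{𝔘ʸ₁₁(n,β)}). -/

import Mathlib

open MeasureTheory Real Set

noncomputable section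

namespace RadHydro

/-- Integral over one period `[-1/2, 1/2]` of the torus `𝕋 ≅ ℝ/ℤ`. -/
def tInt (f : ℝ → ℝ) : ℝ := ∫ x in (-(1/2) : ℝ)..(1/2 : ℝ), f x

/-- Squared `L²` norm over the torus. -/
def L2sq (f : ℝ → ℝ) : ℝ := tInt fun x => (f x) ^ 2

/-- `L^∞` norm over the torus. -/
def Linf (f : ℝ → ℝ) : ℝ := sSup ((fun x => |f x|) '' Icc (-(1/2) : ℝ) (1/2))

/-- Squared `H¹` norm over the torus. -/
def H1sq (f : ℝ → ℝ) : ℝ := L2sq f + L2sq (deriv f)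

/-- Squared `H²` norm over the torus. -/
def H2sq (f : ℝ → ℝ) : ℝ := L2sq f + L2sq (deriv f) + L2sq (deriv (deriv f))

/-- Partial derivative in the time variable. -/
def pt (f : ℝ → ℝ → ℝ) (t x : ℝ) : ℝ := deriv (fun s => f s x) t

/-- Partial derivative in the space variable. -/
def px (f : ℝ → ℝ → ℝ) (t x : ℝ) : ℝ := deriv (f t) x

/-- The heat conductivity `κ(v, θ) = κ₁ + κ₂ v θ^β`. -/
def kappa (κ₁ κ₂ β v θ : ℝ) : ℝ := κ₁ + κ₂ * v * θ ^ β

/-- A smooth solution of the radiation hydrodynamics system (in Lagrangian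
coordinates) on `[0, T]`: four `C^∞` functions on `[0,T] × ℝ` (modelled as smooth
functions on all of `ℝ × ℝ`), `1`-periodic in the space variable, with `v > 0`,
`θ > 0`, satisfying the four equations pointwise for `t ∈ [0, T]`, and with the
normalization `∫_𝕋 v(0, x) dx = 1`. -/
structure Sol (μ R a b κ₁ κ₂ β γ T : ℝ) where
  v : ℝ → ℝ → ℝ
  u : ℝ → ℝ → ℝ
  θ : ℝ → ℝ → ℝ
  q : ℝ → ℝ → ℝ
  smooth_v : ContDiff ℝ (⊤ : ℕ∞) fun p : ℝ × ℝ => v p.1 p.2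
  smooth_u : ContDiff ℝ (⊤ : ℕ∞) fun p : ℝ × ℝ => u p.1 p.2
  smooth_θ : ContDiff ℝ (⊤ : ℕ∞) fun p : ℝ × ℝ => θ p.1 p.2
  smooth_q : ContDiff ℝ (⊤ : ℕ∞) fun p : ℝ × ℝ => q p.1 p.2
  periodic_v : ∀ t, Function.Periodic (v t) 1
  periodic_u : ∀ t, Function.Periodic (u t) 1
  periodic_θ : ∀ t, Function.Periodic (θ t) 1
  periodic_q : ∀ t, Function.Periodic (q t) 1
  v_pos : ∀ t x, 0 < v t x
  θ_pos : ∀ t x, 0 < θ t x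
  eq_mass : ∀ t ∈ Icc (0 : ℝ) T, ∀ x : ℝ, pt v t x - px u t x = 0
  eq_mom : ∀ t ∈ Icc (0 : ℝ) T, ∀ x : ℝ,
    pt u t x + px (fun s y => R * θ s y / v s y) t x
      = px (fun s y => μ * px u s y / v s y) t x
  eq_energy : ∀ t ∈ Icc (0 : ℝ) T, ∀ x : ℝ,
    pt (fun s y => R / (γ - 1) * θ s y + (u s y) ^ 2 / 2) t x
      + px (fun s y => R * θ s y / v s y * u s y) t x + px q t x
      = px (fun s y => μ * u s y * px u s y / v s y) t x
        + px (fun s y => kappa κ₁ κ₂ β (v s y) (θ s y) * px θ s y / v s y) t x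
  eq_rad : ∀ t ∈ Icc (0 : ℝ) T, ∀ x : ℝ,
    -px (fun s y => px q s y / v s y) t x + a * v t x * q t x
      + b * px (fun s y => (θ s y) ^ 4) t x = 0
  mean_v : tInt (v 0) = 1

/-- `(M, ε)`-bounded initial data: `‖(v₀, u₀, θ₀)‖_{H²} ≤ M` and `v₀ ≥ ε`, `θ₀ ≥ ε`. -/
def DataBounded (M ε : ℝ) (v₀ u₀ θ₀ : ℝ → ℝ) : Prop :=
  Real.sqrt (H2sq v₀ + H2sq u₀ + H2sq θ₀) ≤ M ∧ (∀ x, ε ≤ v₀ x) ∧ ∀ x, ε ≤ θ₀ x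

variable {μ R a b κ₁ κ₂ β γ T : ℝ}

/-- A solution has `(M, ε)`-bounded initial data. -/
def Sol.Bounded (S : Sol μ R a b κ₁ κ₂ β γ T) (M ε : ℝ) : Prop :=
  DataBounded M ε (S.v 0) (S.u 0) (S.θ 0)

/-- The auxiliary function `𝔛(t) = ∫₀ᵗ ∫_𝕋 κ(v,θ) θ_t² / v dx ds`. -/
def Sol.X (S : Sol μ R a b κ₁ κ₂ β γ T) (t : ℝ) : ℝ :=
  ∫ s in (0 : ℝ)..t, tInt fun x =>
    kappa κ₁ κ₂ β (S.v s x) (S.θ s x) * (pt S.θ s x) ^ 2 / S.v s x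

/-- The auxiliary function `𝔜(t) = max_{0 ≤ s ≤ t} ∫_𝕋 κ(v,θ)² θ_x² / v² dx`. -/
def Sol.Y (S : Sol μ R a b κ₁ κ₂ β γ T) (t : ℝ) : ℝ :=
  sSup ((fun s => tInt fun x =>
    (kappa κ₁ κ₂ β (S.v s x) (S.θ s x)) ^ 2 * (px S.θ s x) ^ 2 / (S.v s x) ^ 2) ''
      Icc (0 : ℝ) t)

/-- The auxiliary function `ℨ(t) = max_{0 ≤ s ≤ t} ∫_𝕋 u_{xx}² / v² dx`. -/
def Sol.Z (S : Sol μ R a b κ₁ κ₂ β γ T) (t : ℝ) : ℝ :=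
  sSup ((fun s => tInt fun x => (px (px S.u) s x) ^ 2 / (S.v s x) ^ 2) '' Icc (0 : ℝ) t)

/-- The exponent `𝔗₀(n, p, β)`. -/
def T0 (n _p β : ℝ) : ℝ :=
  if n < (β + 3) / 2 then 4 / (n * (2 * β + 3)) else (n - β + 5) / (n * (2 * β + 3))

/-- The exponent `𝔗₁(n, β)`. -/
def T1 (n β : ℝ) : ℝ := max (T0 n 8 β) (1 / (2 * β + 3) + T0 n 1 β)

/-- The exponent `𝔘ʸ₁₁(n, β)`. -/
def Uy11 (n β : ℝ) : ℝ := 2 / (2 * β + 3) + T0 n 1 β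

/-- The exponent `𝔘ᶻ₁₁(n, β)`. -/
def Uz11 (n β : ℝ) : ℝ := 3 / 4 * (1 / (1 - T0 n (5/2) β))

/-- The exponent `𝔘ʸ₂(n, β)`. -/
def Uy2 (n β : ℝ) : ℝ := 2 / (2 * β + 3) + T1 n β

/-- The exponent `𝔘ᶻ₂(n, β)`. -/
def Uz2 (n β : ℝ) : ℝ := 3 / 4 * (1 / (1 - T0 n (3/2) β - T1 n β))

end RadHydro

open RadHydro


/-! ### Smooth functions of time and space -/

/-- A function of time and space is smooth when its uncurried form is `C^∞`. -/
def IsSmooth (f : ℝ → ℝ → ℝ) : Prop := ContDiff ℝ (⊤ : ℕ∞) fun p : ℝ × ℝ => f p.1 p.2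

namespace IsSmooth

variable {f g : ℝ → ℝ → ℝ}

lemma const (c : ℝ) : IsSmooth fun _ _ => c := contDiff_const

lemma add (hf : IsSmooth f) (hg : IsSmooth g) : IsSmooth fun t x => f t x + g t x :=
  ContDiff.add hf hg

lemma sub (hf : IsSmooth f) (hg : IsSmooth g) : IsSmooth fun t x => f t x - g t x :=
  ContDiff.sub hf hg

lemma mul (hf : IsSmooth f) (hg : IsSmooth g) : IsSmooth fun t x => f t x * g t x :=
  ContDiff.mul hf hg

lemma const_mul (c : ℝ) (hf : IsSmooth f) : IsSmooth fun t x => c * f t x :=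
  (const c).mul hf

lemma pow (hf : IsSmooth f) (k : ℕ) : IsSmooth fun t x => f t x ^ k :=
  ContDiff.pow hf k

lemma div (hf : IsSmooth f) (hg : IsSmooth g) (h : ∀ t x, 0 < g t x) :
    IsSmooth fun t x => f t x / g t x :=
  ContDiff.div hf hg fun p => (h p.1 p.2).ne'

lemma rpow (hf : IsSmooth f) (r : ℝ) (h : ∀ t x, 0 < f t x) : IsSmooth fun t x => f t x ^ r :=
  ContDiff.rpow_const_of_ne hf fun p => (h p.1 p.2).ne'

lemma log (hf : IsSmooth f) (h : ∀ t x, 0 < f t x) : IsSmooth fun t x => Real.log (f t x) :=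
  ContDiff.log hf fun p => (h p.1 p.2).ne'

lemma pt_eq (hf : IsSmooth f) (t x : ℝ) :
    HasDerivAt (fun s => f s x) (fderiv ℝ (fun p : ℝ × ℝ => f p.1 p.2) (t, x) (1, 0)) t := by
  have h1 : HasFDerivAt (fun p : ℝ × ℝ => f p.1 p.2) _ (t, x) :=
    (ContDiff.differentiable hf (by simp) (t, x)).hasFDerivAt
  exact h1.comp_hasDerivAt t ((hasDerivAt_id t).prodMk (hasDerivAt_const t x))

lemma px_eq (hf : IsSmooth f) (t x : ℝ) :
    HasDerivAt (f t) (fderiv ℝ (fun p : ℝ × ℝ => f p.1 p.2) (t, x) (0, 1)) x := by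
  have h1 : HasFDerivAt (fun p : ℝ × ℝ => f p.1 p.2) _ (t, x) :=
    (ContDiff.differentiable hf (by simp) (t, x)).hasFDerivAt
  exact h1.comp_hasDerivAt x ((hasDerivAt_const x t).prodMk (hasDerivAt_id x))

lemma hasDerivAt_pt (hf : IsSmooth f) (t x : ℝ) : HasDerivAt (fun s => f s x) (pt f t x) t :=
  (hf.pt_eq t x).differentiableAt.hasDerivAt

lemma hasDerivAt_px (hf : IsSmooth f) (t x : ℝ) : HasDerivAt (f t) (px f t x) x :=
  (hf.px_eq t x).differentiableAt.hasDerivAt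

lemma fderiv_apply (hf : IsSmooth f) (w : ℝ × ℝ) :
    ContDiff ℝ (⊤ : ℕ∞) fun p : ℝ × ℝ => fderiv ℝ (fun p : ℝ × ℝ => f p.1 p.2) p w :=
  (ContDiff.fderiv_right (m := (⊤ : ℕ∞)) hf (by simp)).clm_apply contDiff_const

lemma pt (hf : IsSmooth f) : IsSmooth (pt f) := by
  have h : (fun p : ℝ × ℝ => RadHydro.pt f p.1 p.2)
      = fun p => fderiv ℝ (fun p : ℝ × ℝ => f p.1 p.2) p (1, 0) := by
    funext p; exact (hf.pt_eq p.1 p.2).deriv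
  unfold IsSmooth; rw [h]; exact hf.fderiv_apply _

lemma px (hf : IsSmooth f) : IsSmooth (px f) := by
  have h : (fun p : ℝ × ℝ => RadHydro.px f p.1 p.2)
      = fun p => fderiv ℝ (fun p : ℝ × ℝ => f p.1 p.2) p (0, 1) := by
    funext p; exact (hf.px_eq p.1 p.2).deriv
  unfold IsSmooth; rw [h]; exact hf.fderiv_apply _

lemma px_pt (hf : IsSmooth f) (t x : ℝ) :
    RadHydro.px (RadHydro.pt f) t x = RadHydro.pt (RadHydro.px f) t x := by
  have h1 : RadHydro.pt f
      = fun t x => fderiv ℝ (fun p : ℝ × ℝ => f p.1 p.2) (t, x) (1, 0) := by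
    funext t x; exact (hf.pt_eq t x).deriv
  have h2 : RadHydro.px f
      = fun t x => fderiv ℝ (fun p : ℝ × ℝ => f p.1 p.2) (t, x) (0, 1) := by
    funext t x; exact (hf.px_eq t x).deriv
  have e1 := (hf.pt.px_eq t x).deriv
  have e2 := (hf.px.pt_eq t x).deriv
  have hd : DifferentiableAt ℝ (fderiv ℝ fun p : ℝ × ℝ => f p.1 p.2) (t, x) :=
    (ContDiff.fderiv_right (m := (⊤ : ℕ∞)) hf (by simp)).differentiable (by simp) _
  have hs : IsSymmSndFDerivAt ℝ (fun p : ℝ × ℝ => f p.1 p.2) (t, x) :=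
    (ContDiff.contDiffAt hf).isSymmSndFDerivAt
      (by simpa using WithTop.coe_le_coe.2 (le_top : (2 : ℕ∞) ≤ ⊤))
  have k (w : ℝ × ℝ) :
      fderiv ℝ (fun p : ℝ × ℝ => fderiv ℝ (fun p : ℝ × ℝ => f p.1 p.2) p w) (t, x)
        = (fderiv ℝ (fderiv ℝ fun p : ℝ × ℝ => f p.1 p.2) (t, x)).flip w := by
    have := hd.hasFDerivAt.clm_apply (hasFDerivAt_const w (t, x))
    rw [this.fderiv]; simp
  change deriv (RadHydro.pt f t) x = deriv (fun s => RadHydro.px f s x) t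
  rw [e1, e2, h1, h2]
  simp only [Prod.mk.eta]
  rw [k, k]
  exact hs.eq _ _

lemma continuous_uncurry (hf : IsSmooth f) : Continuous (Function.uncurry f) :=
  ContDiff.continuous hf

lemma continuous_space (hf : IsSmooth f) (t : ℝ) : Continuous (f t) :=
  hf.continuous_uncurry.comp (Continuous.prodMk_right t)

lemma contDiff_space (hf : IsSmooth f) (t : ℝ) : ContDiff ℝ (⊤ : ℕ∞) (f t) :=
  ContDiff.comp (g := fun p : ℝ × ℝ => f p.1 p.2) hf (contDiff_const.prodMk contDiff_id)

end IsSmooth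

lemma periodic_deriv {f : ℝ → ℝ} (hf : Function.Periodic f 1) :
    Function.Periodic (deriv f) 1 := by
  intro x
  have h : (fun y => f (y + 1)) = f := funext hf
  rw [← deriv_comp_add_const, h]

/-! ### Integrals over one period -/

lemma tInt_nonneg {f : ℝ → ℝ} (h : ∀ x, 0 ≤ f x) : 0 ≤ tInt f :=
  intervalIntegral.integral_nonneg (by norm_num) fun x _ => h x

lemma tInt_mono {f g : ℝ → ℝ} (hf : Continuous f) (hg : Continuous g) (h : ∀ x, f x ≤ g x) :
    tInt f ≤ tInt g :=
  intervalIntegral.integral_mono (by norm_num) (hf.intervalIntegrable _ _)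
    (hg.intervalIntegrable _ _) h

lemma tInt_add {f g : ℝ → ℝ} (hf : Continuous f) (hg : Continuous g) :
    tInt (fun x => f x + g x) = tInt f + tInt g :=
  intervalIntegral.integral_add (hf.intervalIntegrable _ _) (hg.intervalIntegrable _ _)

lemma tInt_sub {f g : ℝ → ℝ} (hf : Continuous f) (hg : Continuous g) :
    tInt (fun x => f x - g x) = tInt f - tInt g :=
  intervalIntegral.integral_sub (hf.intervalIntegrable _ _) (hg.intervalIntegrable _ _)

lemma tInt_const_mul (c : ℝ) (f : ℝ → ℝ) : tInt (fun x => c * f x) = c * tInt f :=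
  intervalIntegral.integral_const_mul _ _

lemma tInt_const (c : ℝ) : tInt (fun _ => c) = c := by
  simp only [tInt, intervalIntegral.integral_const, smul_eq_mul]; ring

lemma tInt_deriv_eq_zero {f f' : ℝ → ℝ} (hf : Function.Periodic f 1)
    (h : ∀ x, HasDerivAt f (f' x) x) (hc : Continuous f') : tInt f' = 0 := by
  unfold tInt
  rw [intervalIntegral.integral_eq_sub_of_hasDerivAt (fun x _ => h x)
    (hc.intervalIntegrable _ _)]
  have := hf (-(1/2))
  norm_num at this ⊢
  rw [this, sub_self]

lemma tInt_px_eq_zero {f : ℝ → ℝ → ℝ} (hf : IsSmooth f) (hp : ∀ t, Function.Periodic (f t) 1)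
    (t : ℝ) : tInt (px f t) = 0 :=
  tInt_deriv_eq_zero (hp t) (hf.hasDerivAt_px t) (hf.px.continuous_space t)

/-- A continuous function attains a value not exceeding its mean. -/
lemma exists_le_tInt {f : ℝ → ℝ} (hf : Continuous f) :
    ∃ y ∈ Icc (-(1/2) : ℝ) (1/2), f y ≤ tInt f := by
  by_contra! h
  have h1 : tInt (fun _ => tInt f) < tInt f :=
    intervalIntegral.integral_lt_integral_of_continuousOn_of_le_of_exists_lt (by norm_num)
      continuousOn_const hf.continuousOn (fun x hx => (h x ⟨hx.1.le, hx.2⟩).le)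
      ⟨0, by norm_num, h 0 (by norm_num)⟩
  rw [tInt_const] at h1
  exact lt_irrefl _ h1

/-- Within one period the oscillation of a function is bounded by the integral of any majorant
of the absolute value of its derivative. -/
lemma abs_sub_le_tInt {f f' g : ℝ → ℝ} (h : ∀ x, HasDerivAt f (f' x) x) (hf' : Continuous f')
    (hg : Continuous g) (hle : ∀ x, |f' x| ≤ g x) {x y : ℝ}
    (hx : x ∈ Icc (-(1/2) : ℝ) (1/2)) (hy : y ∈ Icc (-(1/2) : ℝ) (1/2)) :
    |f x - f y| ≤ tInt g := by
  wlog hxy : y ≤ x generalizing x y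
  · rw [abs_sub_comm]; exact this hy hx (le_of_not_ge hxy)
  rw [← intervalIntegral.integral_eq_sub_of_hasDerivAt (fun z _ => h z)
    (hf'.intervalIntegrable _ _)]
  have hg0 : ∀ x, 0 ≤ g x := fun x => (abs_nonneg _).trans (hle x)
  calc |∫ z in y..x, f' z| ≤ ∫ z in y..x, |f' z| :=
        intervalIntegral.abs_integral_le_integral_abs hxy
    _ ≤ ∫ z in y..x, g z := intervalIntegral.integral_mono hxy
        (hf'.abs.intervalIntegrable _ _) (hg.intervalIntegrable _ _) hle
    _ ≤ tInt g := intervalIntegral.integral_mono_interval hy.1 hxy hx.2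
        (Filter.Eventually.of_forall hg0) (hg.intervalIntegrable _ _)

/-- Any real number is a translate by an integer of a point of the fundamental interval. -/
lemma exists_mem_Icc_eq {f : ℝ → ℝ} (hf : Function.Periodic f 1) (x : ℝ) :
    ∃ y ∈ Icc (-(1/2) : ℝ) (1/2), f x = f y := by
  obtain ⟨y, hy, h⟩ := hf.exists_mem_Ico one_pos x (-(1/2))
  exact ⟨y, ⟨hy.1, by linarith [hy.2]⟩, h⟩

lemma sq_tInt_mul_le {f g : ℝ → ℝ} (hf : Continuous f) (hg : Continuous g) :
    tInt (fun x => f x * g x) ^ 2 ≤ tInt (fun x => f x ^ 2) * tInt (fun x => g x ^ 2) := by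
  have key : ∀ l : ℝ, 0 ≤ tInt (fun x => g x ^ 2) * (l * l)
      + (2 * tInt (fun x => f x * g x)) * l + tInt (fun x => f x ^ 2) := by
    intro l
    have h : 0 ≤ tInt fun x => (l * l) * g x ^ 2 + (2 * l) * (f x * g x) + f x ^ 2 :=
      tInt_nonneg fun x => by nlinarith [sq_nonneg (l * g x + f x)]
    rw [tInt_add (by fun_prop) (by fun_prop), tInt_add (by fun_prop) (by fun_prop),
      tInt_const_mul, tInt_const_mul] at h
    linarith
  have := discrim_le_zero key
  unfold discrim at this
  nlinarith

lemma continuous_tInt {f : ℝ → ℝ → ℝ} (hf : Continuous (Function.uncurry f)) :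
    Continuous fun t => tInt (f t) :=
  intervalIntegral.continuous_parametric_intervalIntegral_of_continuous' hf _ _

/-- Differentiation under the integral sign over a bounded interval. -/
lemma hasDerivAt_integral_of_continuous {f f' : ℝ → ℝ → ℝ}
    (h : ∀ t x, HasDerivAt (fun s => f s x) (f' t x) t) (hf : Continuous (Function.uncurry f))
    (hf' : Continuous (Function.uncurry f')) (a b t : ℝ) :
    HasDerivAt (fun s => ∫ x in a..b, f s x) (∫ x in a..b, f' t x) t := by
  have hc : IsCompact (Icc (t - 1) (t + 1) ×ˢ uIcc a b) := isCompact_Icc.prod isCompact_uIcc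
  obtain ⟨K, hK⟩ := hc.exists_bound_of_continuousOn hf'.continuousOn
  have hsl : ∀ {k : ℝ → ℝ → ℝ}, Continuous (Function.uncurry k) → ∀ s, Continuous (k s) :=
    fun hk s => hk.comp (Continuous.prodMk_right s)
  refine (intervalIntegral.hasDerivAt_integral_of_dominated_loc_of_deriv_le
    (bound := fun _ => K) (Icc_mem_nhds (by linarith : t - 1 < t) (by linarith : t < t + 1))
    (Filter.Eventually.of_forall fun s => (hsl hf s).aestronglyMeasurable)
    ((hsl hf t).intervalIntegrable _ _) (hsl hf' t).aestronglyMeasurable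
    (Filter.Eventually.of_forall fun x hx s hs => hK (s, x) ⟨hs, uIoc_subset_uIcc hx⟩)
    intervalIntegrable_const (Filter.Eventually.of_forall fun x _ s _ => h s x)).2

lemma IsSmooth.hasDerivAt_tInt {f : ℝ → ℝ → ℝ} (hf : IsSmooth f) (t : ℝ) :
    HasDerivAt (fun s => tInt (f s)) (tInt (RadHydro.pt f t)) t :=
  hasDerivAt_integral_of_continuous hf.hasDerivAt_pt hf.continuous_uncurry
    hf.pt.continuous_uncurry _ _ t

lemma IsSmooth.continuous_tInt {f : ℝ → ℝ → ℝ} (hf : IsSmooth f) :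
    Continuous fun t => tInt (f t) :=
  _root_.continuous_tInt hf.continuous_uncurry

/-! ### Differential inequalities -/

lemma sub_le_integral_of_hasDerivAt {F F' r : ℝ → ℝ} {t : ℝ} (ht : 0 ≤ t)
    (hF : ∀ s, HasDerivAt F (F' s) s) (hr : Continuous r) (h : ∀ s ∈ Ioo 0 t, F' s ≤ r s) :
    F t - F 0 ≤ ∫ s in (0 : ℝ)..t, r s :=
  intervalIntegral.sub_le_integral_of_hasDeriv_right_of_le ht
    (fun s _ => (hF s).continuousAt.continuousWithinAt)
    (fun s _ => (hF s).hasDerivWithinAt) (hr.continuousOn.integrableOn_Icc) h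

lemma eq_of_hasDerivAt_eq_zero {F F' : ℝ → ℝ} {t : ℝ} (ht : 0 ≤ t)
    (hF : ∀ s, HasDerivAt F (F' s) s) (h : ∀ s ∈ Ioo 0 t, F' s = 0) : F t = F 0 := by
  have h1 := sub_le_integral_of_hasDerivAt ht hF (r := fun _ => 0) continuous_const
    fun s hs => (h s hs).le
  have h2 := sub_le_integral_of_hasDerivAt ht (F := fun s => -F s) (fun s => (hF s).neg)
    (r := fun _ => 0) continuous_const fun s hs => by simp [h s hs]
  simp only [intervalIntegral.integral_zero] at h1 h2
  linarith

lemma le_exp_mul_of_deriv_le {F F' r g : ℝ → ℝ} {t : ℝ} (ht : 0 ≤ t)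
    (hF : ∀ s, HasDerivAt F (F' s) s) (hr : Continuous r) (hg : Continuous g)
    (hr0 : ∀ s, 0 ≤ r s) (hg0 : ∀ s, 0 ≤ g s) (h : ∀ s ∈ Ioo 0 t, F' s ≤ r s + g s * F s) :
    F t ≤ Real.exp (∫ s in (0 : ℝ)..t, g s) * (F 0 + ∫ s in (0 : ℝ)..t, r s) := by
  have hG : ∀ s, HasDerivAt (fun s => ∫ z in (0 : ℝ)..s, g z) (g s) s := fun s =>
    intervalIntegral.integral_hasDerivAt_right (hg.intervalIntegrable _ _)
      hg.aestronglyMeasurable.stronglyMeasurableAtFilter hg.continuousAt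
  have hE : ∀ s, HasDerivAt (fun s => F s * Real.exp (-∫ z in (0 : ℝ)..s, g z))
      (F' s * Real.exp (-∫ z in (0 : ℝ)..s, g z)
        + F s * (Real.exp (-∫ z in (0 : ℝ)..s, g z) * -g s)) s := fun s =>
    (hF s).mul (hG s).neg.exp
  have := sub_le_integral_of_hasDerivAt ht hE hr (fun s hs => by
    have hG0 : 0 ≤ ∫ z in (0 : ℝ)..s, g z :=
      intervalIntegral.integral_nonneg hs.1.le fun z _ => hg0 z
    have he : Real.exp (-∫ z in (0 : ℝ)..s, g z) ≤ 1 := Real.exp_le_one_iff.2 (by linarith)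
    have he0 := Real.exp_pos (-∫ z in (0 : ℝ)..s, g z)
    nlinarith [h s hs, hr0 s])
  simp only [intervalIntegral.integral_same, neg_zero, Real.exp_zero, mul_one] at this
  rw [Real.exp_neg, ← div_eq_mul_inv] at this
  have hp := Real.exp_pos (∫ z in (0 : ℝ)..t, g z)
  have h3 : F t / Real.exp (∫ z in (0 : ℝ)..t, g z) ≤ F 0 + ∫ s in (0 : ℝ)..t, r s := by linarith
  rw [div_le_iff₀ hp] at h3
  linarith


namespace RadHydro

/-! ### The equations in non-conservative form -/

/-- Positivity of all the parameters of the problem. -/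
structure Admissible (μ R a b κ₁ κ₂ β γ T M ε : ℝ) : Prop where
  μ_pos : 0 < μ
  R_pos : 0 < R
  a_pos : 0 < a
  b_pos : 0 < b
  κ₁_pos : 0 < κ₁
  κ₂_pos : 0 < κ₂
  β_pos : 0 < β
  one_lt_γ : 1 < γ
  T_pos : 0 < T
  one_le_M : 1 ≤ M
  ε_pos : 0 < ε
  ε_le_one : ε ≤ 1

variable {μ R a b κ₁ κ₂ β γ T M ε : ℝ}

lemma Admissible.cv_pos (h : Admissible μ R a b κ₁ κ₂ β γ T M ε) : 0 < R / (γ - 1) :=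
  div_pos h.R_pos (by linarith [h.one_lt_γ])

namespace Sol

variable (S : Sol μ R a b κ₁ κ₂ β γ T)

lemma isSmooth_v : IsSmooth S.v := S.smooth_v
lemma isSmooth_u : IsSmooth S.u := S.smooth_u
lemma isSmooth_θ : IsSmooth S.θ := S.smooth_θ
lemma isSmooth_q : IsSmooth S.q := S.smooth_q

/-- The pressure `Rθ/v`. -/
def pressure (t x : ℝ) : ℝ := R * S.θ t x / S.v t x

/-- The viscous stress `μ u_x / v`. -/
def viscousStress (t x : ℝ) : ℝ := μ * px S.u t x / S.v t x

/-- The total stress `μ u_x / v - Rθ/v`. -/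
def stress (t x : ℝ) : ℝ := S.viscousStress t x - S.pressure t x

/-- The conductive heat flux `κ θ_x / v`. -/
def heatFlux (t x : ℝ) : ℝ := kappa κ₁ κ₂ β (S.v t x) (S.θ t x) * px S.θ t x / S.v t x

lemma isSmooth_pressure : IsSmooth S.pressure :=
  (S.isSmooth_θ.const_mul R).div S.isSmooth_v S.v_pos

lemma isSmooth_viscousStress : IsSmooth S.viscousStress :=
  (S.isSmooth_u.px.const_mul μ).div S.isSmooth_v S.v_pos

lemma isSmooth_stress : IsSmooth S.stress :=
  S.isSmooth_viscousStress.sub S.isSmooth_pressure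

lemma isSmooth_kappa : IsSmooth fun t x => kappa κ₁ κ₂ β (S.v t x) (S.θ t x) :=
  (IsSmooth.const κ₁).add ((S.isSmooth_v.const_mul κ₂).mul (S.isSmooth_θ.rpow β S.θ_pos))

lemma isSmooth_heatFlux : IsSmooth S.heatFlux :=
  (S.isSmooth_kappa.mul S.isSmooth_θ.px).div S.isSmooth_v S.v_pos

lemma periodic_px_u (t : ℝ) : Function.Periodic (px S.u t) 1 := periodic_deriv (S.periodic_u t)
lemma periodic_px_θ (t : ℝ) : Function.Periodic (px S.θ t) 1 := periodic_deriv (S.periodic_θ t)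

lemma periodic_pressure (t : ℝ) : Function.Periodic (S.pressure t) 1 := fun x => by
  simp only [pressure, S.periodic_θ t x, S.periodic_v t x]

lemma periodic_viscousStress (t : ℝ) : Function.Periodic (S.viscousStress t) 1 := fun x => by
  simp only [viscousStress, S.periodic_px_u t x, S.periodic_v t x]

lemma periodic_stress (t : ℝ) : Function.Periodic (S.stress t) 1 := fun x => by
  simp only [stress, S.periodic_viscousStress t x, S.periodic_pressure t x]

lemma periodic_heatFlux (t : ℝ) : Function.Periodic (S.heatFlux t) 1 := fun x => by
  simp only [heatFlux, S.periodic_px_θ t x, S.periodic_v t x, S.periodic_θ t x]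

lemma px_stress (t x : ℝ) :
    px S.stress t x = px S.viscousStress t x - px S.pressure t x :=
  ((S.isSmooth_viscousStress.hasDerivAt_px t x).sub
    (S.isSmooth_pressure.hasDerivAt_px t x)).deriv

variable {S} in
lemma pt_v {t : ℝ} (ht : t ∈ Icc 0 T) (x : ℝ) : pt S.v t x = px S.u t x :=
  sub_eq_zero.1 (S.eq_mass t ht x)

variable {S} in
lemma pt_u {t : ℝ} (ht : t ∈ Icc 0 T) (x : ℝ) : pt S.u t x = px S.stress t x := by
  have h : pt S.u t x + px S.pressure t x = px S.viscousStress t x := S.eq_mom t ht x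
  rw [S.px_stress]; linarith

/-- The conservative energy equation, with the heat flux and the stresses named. -/
lemma pt_energy {t : ℝ} (ht : t ∈ Icc 0 T) (x : ℝ) :
    pt (fun s y => R / (γ - 1) * S.θ s y + (S.u s y) ^ 2 / 2) t x
      = px (fun s y => S.u s y * S.stress s y + S.heatFlux s y - S.q s y) t x := by
  have h := S.eq_energy t ht x
  have e1 : (fun s y => μ * S.u s y * px S.u s y / S.v s y)
      = fun s y => S.u s y * S.viscousStress s y := by
    funext s y; simp only [viscousStress]; ring
  have e2 : px (fun s y => S.u s y * S.stress s y + S.heatFlux s y - S.q s y) t x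
      = (px S.u t x * S.stress t x + S.u t x * px S.stress t x) + px S.heatFlux t x
        - px S.q t x :=
    ((((S.isSmooth_u.hasDerivAt_px t x).mul (S.isSmooth_stress.hasDerivAt_px t x)).add
      (S.isSmooth_heatFlux.hasDerivAt_px t x)).sub (S.isSmooth_q.hasDerivAt_px t x)).deriv
  have e3 : px (fun s y => R * S.θ s y / S.v s y * S.u s y) t x
      = px S.pressure t x * S.u t x + S.pressure t x * px S.u t x :=
    ((S.isSmooth_pressure.hasDerivAt_px t x).mul (S.isSmooth_u.hasDerivAt_px t x)).deriv
  have e4 : px (fun s y => S.u s y * S.viscousStress s y) t x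
      = px S.u t x * S.viscousStress t x + S.u t x * px S.viscousStress t x :=
    ((S.isSmooth_u.hasDerivAt_px t x).mul (S.isSmooth_viscousStress.hasDerivAt_px t x)).deriv
  have e5 : px (fun s y => kappa κ₁ κ₂ β (S.v s y) (S.θ s y) * px S.θ s y / S.v s y) t x
      = px S.heatFlux t x := rfl
  rw [e1, e3, e4, e5] at h
  rw [e2, S.px_stress, stress]
  linarith

/-- The balance of internal energy. -/
lemma pt_θ {t : ℝ} (ht : t ∈ Icc 0 T) (x : ℝ) :
    R / (γ - 1) * pt S.θ t x
      = px S.u t x * S.stress t x + px S.heatFlux t x - px S.q t x := by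
  have h := S.pt_energy ht x
  have e2 : px (fun s y => S.u s y * S.stress s y + S.heatFlux s y - S.q s y) t x
      = (px S.u t x * S.stress t x + S.u t x * px S.stress t x) + px S.heatFlux t x
        - px S.q t x :=
    ((((S.isSmooth_u.hasDerivAt_px t x).mul (S.isSmooth_stress.hasDerivAt_px t x)).add
      (S.isSmooth_heatFlux.hasDerivAt_px t x)).sub (S.isSmooth_q.hasDerivAt_px t x)).deriv
  have e3 : pt (fun s y => R / (γ - 1) * S.θ s y + (S.u s y) ^ 2 / 2) t x
      = R / (γ - 1) * pt S.θ t x + S.u t x * pt S.u t x := by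
    refine (((S.isSmooth_θ.hasDerivAt_pt t x).const_mul (R / (γ - 1))).add
      (((S.isSmooth_u.hasDerivAt_pt t x).pow 2).div_const 2)).deriv.trans ?_
    simp; ring
  rw [e2, e3, pt_u ht x] at h
  linarith

/-! ### Conservation of mass and energy -/

lemma tInt_v {t : ℝ} (ht : t ∈ Icc 0 T) : tInt (S.v t) = 1 := by
  rw [← S.mean_v]
  refine eq_of_hasDerivAt_eq_zero ht.1 S.isSmooth_v.hasDerivAt_tInt fun s hs => ?_
  rw [funext (pt_v (S := S) ⟨hs.1.le, hs.2.le.trans ht.2⟩)]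
  exact tInt_px_eq_zero S.isSmooth_u S.periodic_u s

lemma tInt_energy {t : ℝ} (ht : t ∈ Icc 0 T) :
    tInt (fun x => R / (γ - 1) * S.θ t x + (S.u t x) ^ 2 / 2)
      = tInt (fun x => R / (γ - 1) * S.θ 0 x + (S.u 0 x) ^ 2 / 2) := by
  have hs : IsSmooth fun t x => R / (γ - 1) * S.θ t x + (S.u t x) ^ 2 / 2 :=
    (S.isSmooth_θ.const_mul _).add
      ((S.isSmooth_u.pow 2).div (IsSmooth.const 2) fun _ _ => two_pos)
  refine eq_of_hasDerivAt_eq_zero ht.1 hs.hasDerivAt_tInt fun s hs => ?_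
  rw [funext (S.pt_energy ⟨hs.1.le, hs.2.le.trans ht.2⟩)]
  refine tInt_px_eq_zero (((S.isSmooth_u.mul S.isSmooth_stress).add
    S.isSmooth_heatFlux).sub S.isSmooth_q) (fun t x => ?_) s
  simp only [S.periodic_u t x, S.periodic_stress t x, S.periodic_heatFlux t x,
    S.periodic_q t x]

end Sol

/-! ### The radiative flux -/

/-- The radiative flux dissipates entropy. -/
lemma tInt_deriv_div_nonpos {v θ q : ℝ → ℝ} {a b : ℝ} (ha : 0 < a) (hb : 0 < b)
    (hv : ContDiff ℝ (⊤ : ℕ∞) v) (hθ : ContDiff ℝ (⊤ : ℕ∞) θ) (hq : ContDiff ℝ (⊤ : ℕ∞) q)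
    (pv : Function.Periodic v 1) (pθ : Function.Periodic θ 1) (pq : Function.Periodic q 1)
    (v0 : ∀ x, 0 < v x) (θ0 : ∀ x, 0 < θ x)
    (h : ∀ x, -deriv (fun y => deriv q y / v y) x + a * v x * q x
      + b * deriv (fun y => θ y ^ 4) x = 0) :
    tInt (fun x => deriv q x / θ x) ≤ 0 := by
  have hq' : ContDiff ℝ (⊤ : ℕ∞) (deriv q) := ((contDiff_infty_iff_deriv (𝕜 := ℝ)).1 hq).2
  have pq' := periodic_deriv pq
  set w : ℝ → ℝ := fun x => θ x ^ 4 - b⁻¹ * (deriv q x / v x) with hw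
  have dw : ∀ x, HasDerivAt w (-(a / b) * (v x * q x)) x := by
    intro x
    have h1 : HasDerivAt (fun y => deriv q y / v y) (deriv (fun y => deriv q y / v y) x) x :=
      ((hq'.differentiable (by simp) x).div (hv.differentiable (by simp) x)
        (v0 x).ne').hasDerivAt
    have h2 : HasDerivAt (fun y => θ y ^ 4) (deriv (fun y => θ y ^ 4) x) x :=
      ((hθ.differentiable (by simp) x).pow 4).hasDerivAt
    refine (h2.sub (h1.const_mul b⁻¹)).congr_deriv ?_
    have := h x
    field_simp
    linarith
  have dqv : ∀ x, HasDerivAt (fun x => -(a / b) * (v x * q x))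
      (-(a / b) * (deriv v x * q x + v x * deriv q x)) x := fun x =>
    (((hv.differentiable (by simp) x).hasDerivAt.mul
      (hq.differentiable (by simp) x).hasDerivAt)).const_mul _
  have cw : Continuous w := continuous_iff_continuousAt.2 fun x => (dw x).continuousAt
  have pw : Function.Periodic w 1 := fun x => by simp only [hw, pv x, pθ x, pq' x]
  have w0 : ∀ x, 0 < w x := by
    obtain ⟨y, -, hy⟩ := isCompact_Icc.exists_isMinOn
      (nonempty_Icc.2 (by norm_num : (-(1/2) : ℝ) ≤ 1/2)) cw.continuousOn
    have hmin : ∀ x, w y ≤ w x := fun x => by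
      obtain ⟨z, hz, e⟩ := exists_mem_Icc_eq pw x
      rw [e]; exact hy hz
    have hloc : IsLocalMin w y := Filter.Eventually.of_forall hmin
    have hqy : q y = 0 := by
      have := hloc.hasDerivAt_eq_zero (dw y)
      have h1 : a / b ≠ 0 := (div_pos ha hb).ne'
      have h2 := (v0 y).ne'
      simpa [h1, h2, ha.ne', hb.ne'] using this
    have hdw : deriv w = fun x => -(a / b) * (v x * q x) := funext fun x => (dw x).deriv
    have hq0 : deriv q y ≤ 0 := by
      by_contra! hc
      have hneg : -(a / b) * (deriv v y * q y + v y * deriv q y) < 0 := by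
        have := mul_pos (div_pos ha hb) (mul_pos (v0 y) hc)
        rw [hqy]; linarith
      have hmax : IsLocalMax w y := isLocalMax_of_deriv_deriv_neg
        (by rw [hdw, (dqv y).deriv]; exact hneg) (by rw [hdw]; simp [hqy]) cw.continuousAt
      have hev : w =ᶠ[nhds y] fun _ => w y := by
        filter_upwards [hmax] with x hx using le_antisymm hx (hmin x)
      have h2 := (hev.deriv).deriv_eq
      rw [hdw, (dqv y).deriv] at h2
      simp at h2
      rw [hqy] at h2
      have := mul_pos (div_pos ha hb) (mul_pos (v0 y) hc)
      simp [ha.ne', hb.ne', (v0 y).ne', hc.ne'] at h2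
    intro x
    refine lt_of_lt_of_le ?_ (hmin x)
    have h1 : 0 < θ y ^ 4 := pow_pos (θ0 y) 4
    have h2 : b⁻¹ * (deriv q y / v y) ≤ 0 :=
      mul_nonpos_of_nonneg_of_nonpos (inv_pos.2 hb).le
        (div_nonpos_of_nonpos_of_nonneg hq0 (v0 y).le)
    simp only [hw]; linarith
  have hd : ∀ x, HasDerivAt (fun x => q x * w x ^ (-(1/4) : ℝ))
      (deriv q x * w x ^ (-(1/4) : ℝ)
        + q x * (-(a / b) * (v x * q x) * (-(1/4)) * w x ^ (-(1/4) - 1 : ℝ))) x := fun x =>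
    (hq.differentiable (by simp) x).hasDerivAt.mul ((dw x).rpow_const (Or.inl (w0 x).ne'))
  have hcr : ∀ r : ℝ, Continuous fun x => w x ^ r := fun r =>
    cw.rpow_const fun x => Or.inl (w0 x).ne'
  have c1 := hcr (-(1/4))
  have c2 := hcr (-(1/4) - 1)
  have cq := hq.continuous
  have cq' := hq'.continuous
  have cv := hv.continuous
  have hcd : Continuous fun x => deriv q x * w x ^ (-(1/4) : ℝ)
        + q x * (-(a / b) * (v x * q x) * (-(1/4)) * w x ^ (-(1/4) - 1 : ℝ)) := by
    fun_prop
  have hz := tInt_deriv_eq_zero (fun x => by simp only [pq x, pw x]) hd hcd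
  rw [← hz]
  refine tInt_mono (cq'.div hθ.continuous fun x => (θ0 x).ne') hcd fun x => ?_
  have hpos : 0 ≤ q x * (-(a / b) * (v x * q x) * (-(1/4)) * w x ^ (-(1/4) - 1 : ℝ)) := by
    have : q x * (-(a / b) * (v x * q x) * (-(1/4)) * w x ^ (-(1/4) - 1 : ℝ))
        = (1/4) * (a / b) * v x * w x ^ (-(1/4) - 1 : ℝ) * q x ^ 2 := by ring
    rw [this]
    have := v0 x; have := Real.rpow_pos_of_pos (w0 x) (-(1/4) - 1)
    positivity
  have hqe : deriv q x = b * v x * (θ x ^ 4 - w x) := by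
    have := (v0 x).ne'
    simp only [hw]; field_simp; ring
  have hθe : 1 / θ x = (θ x ^ 4) ^ (-(1/4) : ℝ) := by
    rw [← Real.rpow_natCast, ← Real.rpow_mul (θ0 x).le]
    norm_num [Real.rpow_neg_one]
  have key : deriv q x / θ x ≤ deriv q x * w x ^ (-(1/4) : ℝ) := by
    rw [div_eq_mul_one_div, hθe]
    rcases le_total (w x) (θ x ^ 4) with hle | hle
    · have : 0 ≤ deriv q x := by
        rw [hqe]; exact mul_nonneg (mul_pos hb (v0 x)).le (by linarith)
      exact mul_le_mul_of_nonneg_left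
        (Real.rpow_le_rpow_of_nonpos (w0 x) hle (by norm_num)) this
    · have : deriv q x ≤ 0 := by
        rw [hqe]; exact mul_nonpos_of_nonneg_of_nonpos (mul_pos hb (v0 x)).le (by linarith)
      exact mul_le_mul_of_nonpos_left
        (Real.rpow_le_rpow_of_nonpos (pow_pos (θ0 x) 4) hle (by norm_num)) this
  linarith

end RadHydro


namespace RadHydro

/-! ### Sobolev-type inequalities on the torus -/

lemma L2sq_nonneg (f : ℝ → ℝ) : 0 ≤ L2sq f := tInt_nonneg fun _ => sq_nonneg _

lemma H2sq_nonneg (f : ℝ → ℝ) : 0 ≤ H2sq f :=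
  add_nonneg (add_nonneg (L2sq_nonneg _) (L2sq_nonneg _)) (L2sq_nonneg _)

lemma sq_le_L2sq {f : ℝ → ℝ} (hf : ContDiff ℝ (⊤ : ℕ∞) f) (pf : Function.Periodic f 1) (x : ℝ) :
    f x ^ 2 ≤ 2 * L2sq f + L2sq (deriv f) := by
  have hf' : Continuous (deriv f) := ((contDiff_infty_iff_deriv (𝕜 := ℝ)).1 hf).2.continuous
  have cf := hf.continuous
  obtain ⟨z, hz, e⟩ := exists_mem_Icc_eq pf x
  obtain ⟨y, hy, hle⟩ := exists_le_tInt (f := fun x => f x ^ 2) (by fun_prop)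
  have h1 : ∀ x, HasDerivAt (fun x => f x ^ 2) (2 * f x * deriv f x) x := fun x =>
    ((hf.differentiable (by simp) x).hasDerivAt.pow 2).congr_deriv (by simp)
  have h2 := abs_sub_le_tInt h1 (by fun_prop) (g := fun x => f x ^ 2 + deriv f x ^ 2)
    (by fun_prop) (fun x => by
      rw [abs_le]; constructor <;>
        nlinarith [sq_nonneg (f x + deriv f x), sq_nonneg (f x - deriv f x)]) hz hy
  rw [tInt_add (by fun_prop) (by fun_prop)] at h2
  have h3 := (abs_le.1 h2).2
  rw [e]
  unfold L2sq
  linarith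

/-- A positive function is controlled by its mean and a weighted norm of its derivative. -/
lemma rpow_le_tInt {f : ℝ → ℝ} (hf : ContDiff ℝ (⊤ : ℕ∞) f) (pf : Function.Periodic f 1)
    (f0 : ∀ x, 0 < f x) {r : ℝ} (hr : 0 < r) (x : ℝ) :
    f x ^ r ≤ 2 * tInt f ^ r
      + r ^ 2 / 2 * tInt f * tInt (fun x => f x ^ (r - 3) * deriv f x ^ 2) := by
  have hf' : Continuous (deriv f) := ((contDiff_infty_iff_deriv (𝕜 := ℝ)).1 hf).2.continuous
  have cf := hf.continuous
  have cr : ∀ s : ℝ, Continuous fun x => f x ^ s := fun s =>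
    cf.rpow_const fun x => Or.inl (f0 x).ne'
  have c1 := cr (r / 2 - 1)
  have c2 := cr ((r - 3) / 2)
  have c3 := cr (1 / 2)
  obtain ⟨z, hz, e⟩ := exists_mem_Icc_eq pf x
  obtain ⟨y, hy, hle⟩ := exists_le_tInt cf
  have h1 : ∀ x, HasDerivAt (fun x => f x ^ (r / 2)) (deriv f x * (r / 2) * f x ^ (r / 2 - 1)) x :=
    fun x => (hf.differentiable (by simp) x).hasDerivAt.rpow_const (Or.inl (f0 x).ne')
  have split : ∀ x, f x ^ (r / 2 - 1) = f x ^ ((r - 3) / 2) * f x ^ (1 / 2 : ℝ) := fun x => by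
    rw [← Real.rpow_add (f0 x)]; congr 1; ring
  have h2 := abs_sub_le_tInt h1 (by fun_prop)
    (g := fun x => r / 2 * ((f x ^ ((r - 3) / 2) * |deriv f x|) * f x ^ (1 / 2 : ℝ)))
    (by fun_prop) (fun x => by
      rw [abs_mul, abs_mul, abs_of_pos (Real.rpow_pos_of_pos (f0 x) _),
        abs_of_pos (half_pos hr), split]
      apply le_of_eq; ring) hz hy
  rw [tInt_const_mul] at h2
  have h3 := sq_tInt_mul_le (f := fun x => f x ^ ((r - 3) / 2) * |deriv f x|)
    (g := fun x => f x ^ (1 / 2 : ℝ)) (by fun_prop) c3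
  have sq_rpow : ∀ s x : ℝ, (f x ^ s) ^ 2 = f x ^ (s * 2) := fun s x => by
    rw [← Real.rpow_natCast, ← Real.rpow_mul (f0 x).le]; norm_num
  have e1 : (fun x => (f x ^ (1 / 2 : ℝ)) ^ 2) = f := by
    funext x; rw [sq_rpow]; norm_num
  have e2 : (fun x => (f x ^ ((r - 3) / 2) * |deriv f x|) ^ 2)
      = fun x => f x ^ (r - 3) * deriv f x ^ 2 := by
    funext x; rw [mul_pow, sq_rpow, sq_abs]; congr 2; ring
  rw [e1, e2] at h3
  set A := tInt fun x => f x ^ ((r - 3) / 2) * |deriv f x| * f x ^ (1 / 2 : ℝ)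
  have hN : f y ^ (r / 2) ≤ tInt f ^ (r / 2) :=
    Real.rpow_le_rpow (f0 y).le hle (half_pos hr).le
  have h4 : f x ^ (r / 2) ≤ tInt f ^ (r / 2) + r / 2 * A := by
    rw [e]; linarith [(abs_le.1 h2).2]
  have hT : 0 ≤ tInt f := tInt_nonneg fun x => (f0 x).le
  have sqN : (tInt f ^ (r / 2)) ^ 2 = tInt f ^ r := by
    rw [← Real.rpow_natCast, ← Real.rpow_mul hT]; norm_num
  have h5 : f x ^ r = (f x ^ (r / 2)) ^ 2 := by rw [sq_rpow]; congr 1; ring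
  have h6 := pow_le_pow_left₀ (Real.rpow_pos_of_pos (f0 x) (r / 2)).le h4 2
  rw [h5, ← sqN]
  have h7 := mul_le_mul_of_nonneg_left h3 (by positivity : 0 ≤ r ^ 2 / 2)
  nlinarith [sq_nonneg (tInt f ^ (r / 2) - r / 2 * A)]

lemma le_one_add_rpow {x r : ℝ} (hx : 0 < x) (k : ℕ) (hr : (k : ℝ) ≤ r) : x ^ k ≤ 1 + x ^ r := by
  have h0 := Real.rpow_pos_of_pos hx r
  rcases le_total x 1 with h | h
  · linarith [pow_le_one₀ (n := k) hx.le h]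
  · have := Real.rpow_le_rpow_of_exponent_le h hr
    rw [Real.rpow_natCast] at this
    linarith

variable {μ R a b κ₁ κ₂ β γ T M ε : ℝ}

/-! ### Bounds for the initial data -/

lemma H2sq_initial_le {v u θ : ℝ → ℝ} (h : DataBounded M ε v u θ) :
    H2sq v ≤ M ^ 2 ∧ H2sq u ≤ M ^ 2 ∧ H2sq θ ≤ M ^ 2 := by
  have h1 := (Real.sqrt_le_iff.1 h.1).2
  have := H2sq_nonneg v
  have := H2sq_nonneg u
  have := H2sq_nonneg θ
  refine ⟨?_, ?_, ?_⟩ <;> linarith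

lemma L2sq_le_of_H2sq_le {f : ℝ → ℝ} (h : H2sq f ≤ M ^ 2) :
    L2sq f ≤ M ^ 2 ∧ L2sq (deriv f) ≤ M ^ 2 ∧ L2sq (deriv (deriv f)) ≤ M ^ 2 := by
  have := L2sq_nonneg f
  have := L2sq_nonneg (deriv f)
  have := L2sq_nonneg (deriv (deriv f))
  unfold H2sq at h
  refine ⟨?_, ?_, ?_⟩ <;> linarith

lemma sq_le_of_H2sq_le {f : ℝ → ℝ} (hf : ContDiff ℝ (⊤ : ℕ∞) f) (pf : Function.Periodic f 1)
    (h : H2sq f ≤ M ^ 2) (x : ℝ) : f x ^ 2 ≤ 3 * M ^ 2 ∧ deriv f x ^ 2 ≤ 3 * M ^ 2 := by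
  obtain ⟨h1, h2, h3⟩ := L2sq_le_of_H2sq_le h
  have h4 := sq_le_L2sq hf pf x
  have h5 := sq_le_L2sq ((contDiff_infty_iff_deriv (𝕜 := ℝ)).1 hf).2 (periodic_deriv pf) x
  constructor <;> linarith

namespace Sol

variable (S : Sol μ R a b κ₁ κ₂ β γ T)

lemma px_stress_eq (t x : ℝ) :
    px S.stress t x = μ * (px (px S.u) t x / S.v t x - px S.u t x * px S.v t x / S.v t x ^ 2)
      - R * (px S.θ t x / S.v t x - S.θ t x * px S.v t x / S.v t x ^ 2) := by
  have hv := (S.v_pos t x).ne'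
  refine ((((S.isSmooth_u.px.hasDerivAt_px t x).const_mul μ).div
    (S.isSmooth_v.hasDerivAt_px t x) hv).sub
    (((S.isSmooth_θ.hasDerivAt_px t x).const_mul R).div
    (S.isSmooth_v.hasDerivAt_px t x) hv)).deriv.trans ?_
  field_simp

end Sol

/-- The initial velocity has a time derivative bounded in `L²`. -/
lemma exists_L2sq_pt_u_zero_le (h : Admissible μ R a b κ₁ κ₂ β γ T M ε) :
    ∃ C : ℝ, 0 < C ∧ ∀ S : Sol μ R a b κ₁ κ₂ β γ T, S.Bounded M ε → L2sq (pt S.u 0) ≤ C := by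
  have hε := h.ε_pos
  have hμ := h.μ_pos
  have hR := h.R_pos
  have hM := h.one_le_M
  refine ⟨4 * μ ^ 2 * (ε⁻¹) ^ 2 * M ^ 2 + 4 * μ ^ 2 * (3 * M ^ 2) * (ε⁻¹) ^ 4 * M ^ 2
    + (4 * R ^ 2 * (ε⁻¹) ^ 2 * M ^ 2 + 4 * R ^ 2 * (3 * M ^ 2) * (ε⁻¹) ^ 4 * M ^ 2),
    by positivity, fun S hS => ?_⟩
  obtain ⟨bv, bu, bθ⟩ := H2sq_initial_le hS
  obtain ⟨-, lv, -⟩ := L2sq_le_of_H2sq_le bv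
  obtain ⟨-, -, lu⟩ := L2sq_le_of_H2sq_le bu
  obtain ⟨-, lθ, -⟩ := L2sq_le_of_H2sq_le bθ
  have cu := S.isSmooth_u.px.px.continuous_space 0
  have cv := S.isSmooth_v.px.continuous_space 0
  have cθ := S.isSmooth_θ.px.continuous_space 0
  have ct := S.isSmooth_u.pt.continuous_space 0
  have key : L2sq (pt S.u 0) ≤ tInt fun x =>
      4 * μ ^ 2 * (ε⁻¹) ^ 2 * px (px S.u) 0 x ^ 2
      + 4 * μ ^ 2 * (3 * M ^ 2) * (ε⁻¹) ^ 4 * px S.v 0 x ^ 2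
      + (4 * R ^ 2 * (ε⁻¹) ^ 2 * px S.θ 0 x ^ 2
      + 4 * R ^ 2 * (3 * M ^ 2) * (ε⁻¹) ^ 4 * px S.v 0 x ^ 2) := by
    refine tInt_mono (by fun_prop) (by fun_prop) fun x => ?_
    rw [Sol.pt_u ⟨le_rfl, h.T_pos.le⟩, S.px_stress_eq]
    have hi : (S.v 0 x)⁻¹ ≤ ε⁻¹ := inv_anti₀ hε (hS.2.1 x)
    have hi0 : 0 < (S.v 0 x)⁻¹ := inv_pos.2 (S.v_pos 0 x)
    have h2 : (S.v 0 x)⁻¹ ^ 2 ≤ ε⁻¹ ^ 2 := pow_le_pow_left₀ hi0.le hi 2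
    have h4 : (S.v 0 x)⁻¹ ^ 4 ≤ ε⁻¹ ^ 4 := pow_le_pow_left₀ hi0.le hi 4
    have hu : px S.u 0 x ^ 2 ≤ 3 * M ^ 2 :=
      (sq_le_of_H2sq_le (S.isSmooth_u.contDiff_space 0) (S.periodic_u 0) bu x).2
    have hθ : S.θ 0 x ^ 2 ≤ 3 * M ^ 2 :=
      (sq_le_of_H2sq_le (S.isSmooth_θ.contDiff_space 0) (S.periodic_θ 0) bθ x).1
    simp only [div_eq_mul_inv, ← inv_pow]
    generalize (S.v 0 x)⁻¹ = i at *
    have e : ∀ p q r s : ℝ, (p - q - (r - s)) ^ 2 ≤ 4 * p ^ 2 + 4 * q ^ 2 + (4 * r ^ 2 + 4 * s ^ 2) :=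
      fun p q r s => by
        nlinarith [sq_nonneg (p + q), sq_nonneg (p + r), sq_nonneg (p - s), sq_nonneg (q - r),
          sq_nonneg (q + s), sq_nonneg (r + s)]
    rw [mul_sub, mul_sub]
    refine (e _ _ _ _).trans ?_
    have k1 : (μ * (px (px S.u) 0 x * i)) ^ 2 ≤ μ ^ 2 * ε⁻¹ ^ 2 * px (px S.u) 0 x ^ 2 := by
      calc (μ * (px (px S.u) 0 x * i)) ^ 2 = μ ^ 2 * i ^ 2 * px (px S.u) 0 x ^ 2 := by ring
        _ ≤ _ := by gcongr
    have k3 : (R * (px S.θ 0 x * i)) ^ 2 ≤ R ^ 2 * ε⁻¹ ^ 2 * px S.θ 0 x ^ 2 := by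
      calc (R * (px S.θ 0 x * i)) ^ 2 = R ^ 2 * i ^ 2 * px S.θ 0 x ^ 2 := by ring
        _ ≤ _ := by gcongr
    have k2 : (μ * (px S.u 0 x * px S.v 0 x * i ^ 2)) ^ 2
        ≤ μ ^ 2 * (3 * M ^ 2) * ε⁻¹ ^ 4 * px S.v 0 x ^ 2 := by
      calc (μ * (px S.u 0 x * px S.v 0 x * i ^ 2)) ^ 2
          = μ ^ 2 * px S.u 0 x ^ 2 * i ^ 4 * px S.v 0 x ^ 2 := by ring
        _ ≤ _ := by gcongr
    have k4 : (R * (S.θ 0 x * px S.v 0 x * i ^ 2)) ^ 2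
        ≤ R ^ 2 * (3 * M ^ 2) * ε⁻¹ ^ 4 * px S.v 0 x ^ 2 := by
      calc (R * (S.θ 0 x * px S.v 0 x * i ^ 2)) ^ 2
          = R ^ 2 * S.θ 0 x ^ 2 * i ^ 4 * px S.v 0 x ^ 2 := by ring
        _ ≤ _ := by gcongr
    linarith
  rw [tInt_add (by fun_prop) (by fun_prop), tInt_add (by fun_prop) (by fun_prop),
    tInt_add (by fun_prop) (by fun_prop), tInt_const_mul, tInt_const_mul, tInt_const_mul,
    tInt_const_mul] at key
  refine key.trans ?_
  have lv' : tInt (fun x => px S.v 0 x ^ 2) ≤ M ^ 2 := lv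
  have lu' : tInt (fun x => px (px S.u) 0 x ^ 2) ≤ M ^ 2 := lu
  have lθ' : tInt (fun x => px S.θ 0 x ^ 2) ≤ M ^ 2 := lθ
  gcongr

/-! ### Energy and entropy estimates -/

lemma exists_energy_le (h : Admissible μ R a b κ₁ κ₂ β γ T M ε) :
    ∃ C : ℝ, 0 < C ∧ ∀ S : Sol μ R a b κ₁ κ₂ β γ T, S.Bounded M ε → ∀ t ∈ Icc 0 T,
      tInt (S.θ t) ≤ C ∧ L2sq (S.u t) ≤ C := by
  have hcv := h.cv_pos
  have hM := h.one_le_M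
  set cv := R / (γ - 1) with hcv'
  set E := cv * (1 + M ^ 2) + M ^ 2 with hE
  have hE0 : 0 < E := by positivity
  refine ⟨E / cv + 2 * E, by positivity, fun S hS t ht => ?_⟩
  obtain ⟨-, bu, bθ⟩ := H2sq_initial_le hS
  have lu := (L2sq_le_of_H2sq_le bu).1
  have lθ := (L2sq_le_of_H2sq_le bθ).1
  have c : ∀ s, Continuous (S.θ s) := S.isSmooth_θ.continuous_space
  have d : ∀ s, Continuous (S.u s) := S.isSmooth_u.continuous_space
  have split : ∀ s, tInt (fun x => cv * S.θ s x + S.u s x ^ 2 / 2)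
      = cv * tInt (S.θ s) + L2sq (S.u s) / 2 := fun s => by
    have := c s
    have := d s
    simp only [div_eq_inv_mul (b := (2 : ℝ))]
    rw [tInt_add (by fun_prop) (by fun_prop), tInt_const_mul, tInt_const_mul]
    rfl
  have h1 := S.tInt_energy ht
  rw [← hcv', split, split] at h1
  have h2 : tInt (S.θ 0) ≤ 1 + M ^ 2 := by
    have := c 0
    have h3 : tInt (S.θ 0) ≤ tInt fun x => 1 + S.θ 0 x ^ 2 :=
      tInt_mono (c 0) (by fun_prop) fun x => by nlinarith [sq_nonneg (S.θ 0 x - 1)]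
    rw [tInt_add (by fun_prop) (by fun_prop), tInt_const] at h3
    exact h3.trans (by unfold L2sq at lθ; linarith)
  have h4 : cv * tInt (S.θ 0) ≤ cv * (1 + M ^ 2) := by gcongr
  have h5 : 0 ≤ tInt (S.θ t) := tInt_nonneg fun x => (S.θ_pos t x).le
  have h6 := L2sq_nonneg (S.u t)
  have h7 : cv * tInt (S.θ t) ≤ E := by nlinarith [sq_nonneg M]
  have h8 : tInt (S.θ t) ≤ E / cv := by rw [le_div_iff₀ hcv]; linarith
  have h9 : 0 ≤ cv * tInt (S.θ t) := by positivity
  have h10 : 0 < E / cv := by positivity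
  constructor <;> nlinarith [sq_nonneg M]

/-- The weighted Dirichlet integral `∫ θ^(β-2) θ_x²` controlled by the entropy production. -/
def Sol.entropyProd (S : Sol μ R a b κ₁ κ₂ β γ T) (t : ℝ) : ℝ :=
  tInt fun x => S.θ t x ^ (β - 2) * px S.θ t x ^ 2

lemma Sol.isSmooth_entropyDensity (S : Sol μ R a b κ₁ κ₂ β γ T) :
    IsSmooth fun t x => S.θ t x ^ (β - 2) * px S.θ t x ^ 2 :=
  (S.isSmooth_θ.rpow _ S.θ_pos).mul (S.isSmooth_θ.px.pow 2)

lemma Sol.continuous_entropyProd (S : Sol μ R a b κ₁ κ₂ β γ T) : Continuous S.entropyProd :=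
  S.isSmooth_entropyDensity.continuous_tInt

lemma Sol.entropyProd_nonneg (S : Sol μ R a b κ₁ κ₂ β γ T) (t : ℝ) : 0 ≤ S.entropyProd t :=
  tInt_nonneg fun x => mul_nonneg (Real.rpow_pos_of_pos (S.θ_pos t x) _).le (sq_nonneg _)

lemma Sol.entropyProd_le (h : Admissible μ R a b κ₁ κ₂ β γ T M ε)
    (S : Sol μ R a b κ₁ κ₂ β γ T) {t : ℝ} (ht : t ∈ Icc 0 T) :
    κ₂ * S.entropyProd t
      ≤ tInt (pt (fun t x => R / (γ - 1) * Real.log (S.θ t x) + R * Real.log (S.v t x)) t) := by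
  have hκ₂ := h.κ₂_pos
  have hκ₁ := h.κ₁_pos
  have hμ := h.μ_pos
  have hsm : IsSmooth fun t x => R / (γ - 1) * Real.log (S.θ t x) + R * Real.log (S.v t x) :=
    ((S.isSmooth_θ.log S.θ_pos).const_mul _).add ((S.isSmooth_v.log S.v_pos).const_mul _)
  have hflux : IsSmooth fun t x => S.heatFlux t x / S.θ t x :=
    S.isSmooth_heatFlux.div S.isSmooth_θ S.θ_pos
  have hqθ : IsSmooth fun t x => px S.q t x / S.θ t x := S.isSmooth_q.px.div S.isSmooth_θ S.θ_pos
  have hzero : tInt (px (fun t x => S.heatFlux t x / S.θ t x) t) = 0 :=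
    tInt_px_eq_zero hflux (fun t x => by simp only [S.periodic_heatFlux t x, S.periodic_θ t x]) t
  have hq : tInt (fun x => px S.q t x / S.θ t x) ≤ 0 :=
    tInt_deriv_div_nonpos h.a_pos h.b_pos (S.isSmooth_v.contDiff_space t)
      (S.isSmooth_θ.contDiff_space t) (S.isSmooth_q.contDiff_space t) (S.periodic_v t)
      (S.periodic_θ t) (S.periodic_q t) (S.v_pos t) (S.θ_pos t) (S.eq_rad t ht)
  have c1 := S.isSmooth_entropyDensity.continuous_space t
  have c2 := hflux.px.continuous_space t
  have c3 := hqθ.continuous_space t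
  have key : tInt (fun x => κ₂ * (S.θ t x ^ (β - 2) * px S.θ t x ^ 2)
      + px (fun t x => S.heatFlux t x / S.θ t x) t x - px S.q t x / S.θ t x)
      ≤ tInt (pt (fun t x => R / (γ - 1) * Real.log (S.θ t x) + R * Real.log (S.v t x)) t) := by
    refine tInt_mono (by fun_prop) (hsm.pt.continuous_space t) fun x => ?_
    have hθ := S.θ_pos t x
    have hv := S.v_pos t x
    have e1 : pt (fun t x => R / (γ - 1) * Real.log (S.θ t x) + R * Real.log (S.v t x)) t x
        = R / (γ - 1) * (pt S.θ t x / S.θ t x) + R * (pt S.v t x / S.v t x) :=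
      ((((S.isSmooth_θ.hasDerivAt_pt t x).log hθ.ne').const_mul _).add
        (((S.isSmooth_v.hasDerivAt_pt t x).log hv.ne').const_mul _)).deriv
    have e2 : px (fun t x => S.heatFlux t x / S.θ t x) t x
        = (px S.heatFlux t x * S.θ t x - S.heatFlux t x * px S.θ t x) / S.θ t x ^ 2 :=
      ((S.isSmooth_heatFlux.hasDerivAt_px t x).div (S.isSmooth_θ.hasDerivAt_px t x) hθ.ne').deriv
    have e3 : R / (γ - 1) * (pt S.θ t x / S.θ t x) + R * (pt S.v t x / S.v t x)
        = (px S.u t x * S.stress t x + px S.heatFlux t x - px S.q t x) / S.θ t x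
          + R * (px S.u t x / S.v t x) := by
      rw [← mul_div_assoc, S.pt_θ ht, Sol.pt_v ht]
    have e4 : S.θ t x ^ (β - 2) = S.θ t x ^ β / S.θ t x ^ 2 := by
      rw [Real.rpow_sub hθ]; norm_num
    rw [e1, e3, e2, e4]
    have h1 : 0 ≤ μ * px S.u t x ^ 2 / (S.v t x * S.θ t x)
        + κ₁ * px S.θ t x ^ 2 / (S.v t x * S.θ t x ^ 2) := by positivity
    have h2 : (px S.u t x * S.stress t x + px S.heatFlux t x - px S.q t x) / S.θ t x
          + R * (px S.u t x / S.v t x)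
        - (κ₂ * (S.θ t x ^ β / S.θ t x ^ 2 * px S.θ t x ^ 2)
          + (px S.heatFlux t x * S.θ t x - S.heatFlux t x * px S.θ t x) / S.θ t x ^ 2
          - px S.q t x / S.θ t x)
        = μ * px S.u t x ^ 2 / (S.v t x * S.θ t x)
        + κ₁ * px S.θ t x ^ 2 / (S.v t x * S.θ t x ^ 2) := by
      simp only [Sol.stress, Sol.viscousStress, Sol.pressure, Sol.heatFlux, kappa]
      generalize px (fun t x => _) t x = H
      field_simp
      ring
    linarith
  rw [tInt_sub (by fun_prop) (by fun_prop), tInt_add (by fun_prop) (by fun_prop),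
    tInt_const_mul] at key
  have hzero' : tInt (fun x => px (fun t x => S.heatFlux t x / S.θ t x) t x) = 0 := hzero
  unfold Sol.entropyProd
  linarith

lemma exists_integral_entropyProd_le (h : Admissible μ R a b κ₁ κ₂ β γ T M ε) :
    ∃ C : ℝ, 0 < C ∧ ∀ S : Sol μ R a b κ₁ κ₂ β γ T, S.Bounded M ε → ∀ t ∈ Icc 0 T,
      ∫ s in (0 : ℝ)..t, S.entropyProd s ≤ C := by
  obtain ⟨C, hC, hE⟩ := exists_energy_le h
  have hcv := h.cv_pos
  have hR := h.R_pos
  have hκ₂ := h.κ₂_pos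
  have hlog : Real.log ε ≤ 0 := Real.log_nonpos h.ε_pos.le h.ε_le_one
  set cv := R / (γ - 1) with hcv'
  refine ⟨(cv * C + R - (cv + R) * Real.log ε) / κ₂, div_pos ?_ hκ₂, fun S hS t ht => ?_⟩
  · have := mul_nonneg (add_pos hcv hR).le (neg_nonneg.2 hlog)
    have := mul_pos hcv hC
    linarith
  have hsm : IsSmooth fun t x => cv * Real.log (S.θ t x) + R * Real.log (S.v t x) :=
    ((S.isSmooth_θ.log S.θ_pos).const_mul _).add ((S.isSmooth_v.log S.v_pos).const_mul _)
  have hD := S.continuous_entropyProd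
  have h1 := sub_le_integral_of_hasDerivAt ht.1 (fun s => (hsm.hasDerivAt_tInt s).neg)
    (r := fun s => -(κ₂ * S.entropyProd s)) (by fun_prop)
    fun s hs => neg_le_neg (S.entropyProd_le h ⟨hs.1.le, hs.2.le.trans ht.2⟩)
  rw [intervalIntegral.integral_neg, intervalIntegral.integral_const_mul] at h1
  have cθ := S.isSmooth_θ.continuous_space t
  have cv' := S.isSmooth_v.continuous_space t
  have h2 : tInt (fun x => cv * Real.log (S.θ t x) + R * Real.log (S.v t x)) ≤ cv * C + R := by
    have : tInt (fun x => cv * Real.log (S.θ t x) + R * Real.log (S.v t x))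
        ≤ tInt fun x => cv * S.θ t x + R * S.v t x := by
      refine tInt_mono (hsm.continuous_space t) (by fun_prop) fun x => ?_
      have := Real.log_le_sub_one_of_pos (S.θ_pos t x)
      have := Real.log_le_sub_one_of_pos (S.v_pos t x)
      gcongr <;> linarith
    rw [tInt_add (f := fun x => cv * S.θ t x) (by fun_prop) (by fun_prop), tInt_const_mul,
      tInt_const_mul] at this
    have e1 : tInt (fun x => S.v t x) = 1 := S.tInt_v ht
    have e2 : tInt (fun x => S.θ t x) ≤ C := (hE S hS t ht).1
    rw [e1] at this
    have := mul_le_mul_of_nonneg_left e2 hcv.le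
    linarith
  have h3 : (cv + R) * Real.log ε
      ≤ tInt (fun x => cv * Real.log (S.θ 0 x) + R * Real.log (S.v 0 x)) := by
    rw [← tInt_const ((cv + R) * Real.log ε)]
    refine tInt_mono (by fun_prop) (hsm.continuous_space 0) fun x => ?_
    rw [add_mul]
    have := Real.log_le_log h.ε_pos (hS.2.1 x)
    have := Real.log_le_log h.ε_pos (hS.2.2 x)
    gcongr
  rw [le_div_iff₀ hκ₂]
  simp only [Pi.neg_apply] at h1
  linarith

lemma exists_θ_le (h : Admissible μ R a b κ₁ κ₂ β γ T M ε) :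
    ∃ C : ℝ, 0 < C ∧ ∀ S : Sol μ R a b κ₁ κ₂ β γ T, S.Bounded M ε → ∀ t ∈ Icc 0 T, ∀ x,
      S.θ t x ≤ C * (1 + S.entropyProd t) ∧
      S.θ t x ^ 2 ≤ C * (1 + tInt fun x => S.θ t x ^ (2 * β) * px S.θ t x ^ 2) := by
  obtain ⟨C, hC, hE⟩ := exists_energy_le h
  have hβ := h.β_pos
  set A := 1 + 2 * C ^ (1 + β) + (1 + β) ^ 2 / 2 * C with hA
  set B := 1 + 2 * C ^ (2 * β + 3) + (2 * β + 3) ^ 2 / 2 * C with hB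
  have hA0 : 0 < A := by positivity
  have hB0 : 0 < B := by positivity
  refine ⟨A + B, by positivity, fun S hS t ht x => ?_⟩
  have hN := (hE S hS t ht).1
  have hN0 : 0 ≤ tInt (S.θ t) := tInt_nonneg fun x => (S.θ_pos t x).le
  have gen : ∀ r : ℝ, 0 < r → ∀ D : ℝ, 0 ≤ D →
      tInt (fun x => S.θ t x ^ (r - 3) * deriv (S.θ t) x ^ 2) = D →
      1 + S.θ t x ^ r ≤ (1 + 2 * C ^ r + r ^ 2 / 2 * C) * (1 + D) := by
    intro r hr D hD0 hD
    have h1 := rpow_le_tInt (S.isSmooth_θ.contDiff_space t) (S.periodic_θ t) (S.θ_pos t) hr x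
    rw [hD] at h1
    have h2 : tInt (S.θ t) ^ r ≤ C ^ r := Real.rpow_le_rpow hN0 hN hr.le
    have h3 : r ^ 2 / 2 * tInt (S.θ t) * D ≤ r ^ 2 / 2 * C * D := by gcongr
    have h4 : 0 ≤ (1 + 2 * C ^ r) * D := by positivity
    have h5 : 0 ≤ r ^ 2 / 2 * C := by positivity
    linarith
  have hD1 := S.entropyProd_nonneg t
  have hD2 : 0 ≤ tInt fun x => S.θ t x ^ (2 * β) * px S.θ t x ^ 2 :=
    tInt_nonneg fun x => mul_nonneg (Real.rpow_pos_of_pos (S.θ_pos t x) _).le (sq_nonneg _)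
  have g1 := gen (1 + β) (by positivity) (S.entropyProd t) hD1 (by
    rw [show 1 + β - 3 = β - 2 by ring]; rfl)
  have g2 := gen (2 * β + 3) (by positivity) _ hD2 (by
    rw [show 2 * β + 3 - 3 = 2 * β by ring]; rfl)
  have l1 := le_one_add_rpow (S.θ_pos t x) 1 (r := 1 + β) (by norm_num; linarith)
  have l2 := le_one_add_rpow (S.θ_pos t x) 2 (r := 2 * β + 3) (by norm_num; linarith)
  rw [pow_one] at l1
  rw [← hA] at g1
  rw [← hB] at g2
  constructor
  · have : 0 ≤ B * (1 + S.entropyProd t) := by positivity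
    linarith
  · have := mul_nonneg hA0.le (add_nonneg zero_le_one hD2)
    linarith

end RadHydro


namespace RadHydro

variable {μ R a b κ₁ κ₂ β γ T M ε : ℝ}

/-! ### Bounds for the specific volume -/

namespace Sol

variable (S : Sol μ R a b κ₁ κ₂ β γ T)

/-- The time integral of the stress. -/
def impulse (t x : ℝ) : ℝ := ∫ s in (0 : ℝ)..t, S.stress s x

lemma hasDerivAt_impulse (t x : ℝ) : HasDerivAt (fun s => S.impulse s x) (S.stress t x) t := by
  have hc : Continuous fun s => S.stress s x :=
    S.isSmooth_stress.continuous_uncurry.comp (Continuous.prodMk_left x)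
  exact intervalIntegral.integral_hasDerivAt_right (hc.intervalIntegrable _ _)
    hc.aestronglyMeasurable.stronglyMeasurableAtFilter hc.continuousAt

lemma continuous_impulse : Continuous (Function.uncurry S.impulse) := by
  have h1 : Continuous (Function.uncurry fun x s => S.stress s x) :=
    S.isSmooth_stress.continuous_uncurry.comp continuous_swap
  have h2 := intervalIntegral.continuous_parametric_primitive_of_continuous
    (μ := volume) (a₀ := 0) h1
  exact h2.comp continuous_swap

lemma periodic_impulse (t : ℝ) : Function.Periodic (S.impulse t) 1 := fun x => by
  simp only [impulse, S.periodic_stress _ x]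

lemma impulse_zero (x : ℝ) : S.impulse 0 x = 0 := intervalIntegral.integral_same

lemma impulse_sub_impulse {t : ℝ} (ht : t ∈ Icc 0 T) (x y : ℝ) :
    S.impulse t x - S.impulse t y = (∫ z in y..x, S.u t z) - ∫ z in y..x, S.u 0 z := by
  have h1 : ∀ s, HasDerivAt
      (fun s => S.impulse s x - S.impulse s y - ∫ z in y..x, S.u s z)
      (S.stress s x - S.stress s y - ∫ z in y..x, pt S.u s z) s := fun s =>
    ((S.hasDerivAt_impulse s x).sub (S.hasDerivAt_impulse s y)).sub
      (hasDerivAt_integral_of_continuous S.isSmooth_u.hasDerivAt_pt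
        S.isSmooth_u.continuous_uncurry S.isSmooth_u.pt.continuous_uncurry y x s)
  have h2 := eq_of_hasDerivAt_eq_zero ht.1 h1 fun s hs => by
    rw [funext (pt_u (S := S) ⟨hs.1.le, hs.2.le.trans ht.2⟩),
      intervalIntegral.integral_eq_sub_of_hasDerivAt
        (fun z _ => S.isSmooth_stress.hasDerivAt_px s z)
        ((S.isSmooth_stress.px.continuous_space s).intervalIntegrable _ _), sub_self]
  simp only [impulse_zero] at h2
  linarith

/-- The exponential of the scaled impulse, the integrating factor for the specific volume. -/
def intFactor (t x : ℝ) : ℝ := Real.exp (-S.impulse t x / μ)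

lemma intFactor_pos (t x : ℝ) : 0 < S.intFactor t x := Real.exp_pos _

lemma continuous_intFactor : Continuous (Function.uncurry S.intFactor) :=
  Real.continuous_exp.comp (S.continuous_impulse.neg.div_const μ)

lemma hasDerivAt_v_mul_intFactor (t x : ℝ) :
    HasDerivAt (fun s => S.v s x * S.intFactor s x)
      ((pt S.v t x - S.v t x * S.stress t x / μ) * S.intFactor t x) t := by
  refine ((S.isSmooth_v.hasDerivAt_pt t x).mul
    ((S.hasDerivAt_impulse t x).neg.div_const μ).exp).congr_deriv ?_
  simp only [intFactor]
  simp only [Pi.neg_apply]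
  ring

lemma deriv_v_mul_intFactor (hμ : μ ≠ 0) {t : ℝ} (ht : t ∈ Icc 0 T) (x : ℝ) :
    (pt S.v t x - S.v t x * S.stress t x / μ) * S.intFactor t x
      = R / μ * S.θ t x * S.intFactor t x := by
  have hv := (S.v_pos t x).ne'
  rw [pt_v ht]
  congr 1
  simp only [stress, viscousStress, pressure]
  field_simp
  ring

end Sol

lemma exists_impulse_le (h : Admissible μ R a b κ₁ κ₂ β γ T M ε) :
    ∃ C : ℝ, 0 < C ∧ ∀ S : Sol μ R a b κ₁ κ₂ β γ T, S.Bounded M ε → ∀ t ∈ Icc 0 T, ∀ x y,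
      S.impulse t x ≤ S.impulse t y + C := by
  obtain ⟨C, hC, hE⟩ := exists_energy_le h
  refine ⟨2 * (1 + C), by positivity, fun S hS t ht x y => ?_⟩
  obtain ⟨x', hx, ex⟩ := exists_mem_Icc_eq (S.periodic_impulse t) x
  obtain ⟨y', hy, ey⟩ := exists_mem_Icc_eq (S.periodic_impulse t) y
  rw [ex, ey]
  have bound : ∀ s ∈ Icc 0 T, |∫ z in y'..x', S.u s z| ≤ 1 + C := by
    intro s hs
    have cu := S.isSmooth_u.continuous_space s
    have h1 := abs_sub_le_tInt (f := fun x => ∫ z in y'..x, S.u s z)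
      (fun x => intervalIntegral.integral_hasDerivAt_right (cu.intervalIntegrable _ _)
        cu.aestronglyMeasurable.stronglyMeasurableAtFilter cu.continuousAt) cu
      (g := fun z => 1 + S.u s z ^ 2) (by fun_prop)
      (fun z => by
        rw [abs_le]
        constructor <;> nlinarith [sq_nonneg (S.u s z - 1), sq_nonneg (S.u s z + 1)]) hx hy
    rw [intervalIntegral.integral_same, sub_zero, tInt_add (by fun_prop) (by fun_prop),
      tInt_const] at h1
    exact h1.trans (by have := (hE S hS s hs).2; unfold L2sq at this; linarith)
  have h0 := (abs_le.1 (bound 0 ⟨le_rfl, h.T_pos.le⟩)).1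
  have h1 := (abs_le.1 (bound t ht)).2
  linarith [S.impulse_sub_impulse ht x' y']

lemma exists_v_bounds (h : Admissible μ R a b κ₁ κ₂ β γ T M ε) :
    ∃ c C : ℝ, 0 < c ∧ 0 < C ∧ ∀ S : Sol μ R a b κ₁ κ₂ β γ T, S.Bounded M ε →
      ∀ t ∈ Icc 0 T, ∀ x, c ≤ S.v t x ∧ S.v t x ≤ C := by
  obtain ⟨CE, hCE, hE⟩ := exists_energy_le h
  obtain ⟨CI, hCI, hI⟩ := exists_impulse_le h
  obtain ⟨CD, hCD, hD⟩ := exists_integral_entropyProd_le h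
  obtain ⟨Cθ, hCθ, hθ⟩ := exists_θ_le h
  have hμ := h.μ_pos
  have hR := h.R_pos
  have hε := h.ε_pos
  have hT := h.T_pos
  have hM := h.one_le_M
  set B := Real.exp (CI / μ) with hB
  have hB0 : 0 < B := Real.exp_pos _
  set G := R / μ * CE * B ^ 2 with hG
  have hG0 : 0 < G := by positivity
  set L := B * Real.exp (G * T) with hL
  have hL0 : 0 < L := by positivity
  refine ⟨ε / (B * L), B ^ 2 * (1 + 3 * M ^ 2 + R / μ * B * L * Cθ * (T + CD)),
    by positivity, by positivity, fun S hS => ?_⟩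
  have compare : ∀ t ∈ Icc 0 T, ∀ x y, S.intFactor t x ≤ B * S.intFactor t y := by
    intro t ht x y
    simp only [Sol.intFactor, hB]
    rw [← Real.exp_add, Real.exp_le_exp, ← add_div]
    gcongr
    linarith [hI S hS t ht y x]
  have cv := S.isSmooth_v.continuous_space
  have cθ := S.isSmooth_θ.continuous_space
  have cF : ∀ t, Continuous (S.intFactor t) := fun t =>
    S.continuous_intFactor.comp (Continuous.prodMk_right t)
  have cf : Continuous (Function.uncurry fun t x => S.v t x * S.intFactor t x) :=
    S.isSmooth_v.continuous_uncurry.mul S.continuous_intFactor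
  have cf' : Continuous (Function.uncurry fun t x =>
      (pt S.v t x - S.v t x * S.stress t x / μ) * S.intFactor t x) :=
    (S.isSmooth_v.pt.continuous_uncurry.sub ((S.isSmooth_v.continuous_uncurry.mul
      S.isSmooth_stress.continuous_uncurry).div_const μ)).mul S.continuous_intFactor
  have factor_le_J : ∀ t ∈ Icc 0 T, ∀ y,
      S.intFactor t y ≤ B * tInt fun x => S.v t x * S.intFactor t x := by
    intro t ht y
    have cv := cv t
    have cF := cF t
    have : tInt (fun x => S.intFactor t y * S.v t x)
        ≤ tInt fun x => B * (S.v t x * S.intFactor t x) := by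
      refine tInt_mono (by fun_prop) (by fun_prop) fun x => ?_
      have := mul_le_mul_of_nonneg_left (compare t ht y x) (S.v_pos t x).le
      linarith
    rw [tInt_const_mul, tInt_const_mul] at this
    have e : tInt (fun x => S.v t x) = 1 := S.tInt_v ht
    rwa [e, mul_one] at this
  have J_le : ∀ t ∈ Icc 0 T, tInt (fun x => S.v t x * S.intFactor t x) ≤ Real.exp (G * T) := by
    intro t ht
    have hJ := le_exp_mul_of_deriv_le ht.1
      (hasDerivAt_integral_of_continuous S.hasDerivAt_v_mul_intFactor cf cf' (-(1/2)) (1/2))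
      (r := fun _ => 0) (g := fun _ => G) continuous_const continuous_const
      (fun _ => le_rfl) (fun _ => hG0.le) (fun s hs => by
        have hs' : s ∈ Icc 0 T := ⟨hs.1.le, hs.2.le.trans ht.2⟩
        have cθ := cθ s
        have cF := cF s
        rw [zero_add]
        have e : (fun x => (pt S.v s x - S.v s x * S.stress s x / μ) * S.intFactor s x)
            = fun x => R / μ * S.θ s x * S.intFactor s x :=
          funext (S.deriv_v_mul_intFactor hμ.ne' hs')
        rw [e]
        have h1 : tInt (fun x => R / μ * S.θ s x * S.intFactor s x)
            ≤ tInt fun x => R / μ * B * S.intFactor s 0 * S.θ s x := by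
          refine tInt_mono (by fun_prop) (by fun_prop) fun x => ?_
          have := mul_le_mul_of_nonneg_left (compare s hs' x 0)
            (mul_pos (div_pos hR hμ) (S.θ_pos s x)).le
          linarith
        rw [tInt_const_mul] at h1
        have h2 : tInt (fun x => S.θ s x) ≤ CE := (hE S hS s hs').1
        have h3 := S.intFactor_pos s 0
        have h4 := factor_le_J s hs' 0
        refine h1.trans ?_
        calc R / μ * B * S.intFactor s 0 * tInt (fun x => S.θ s x)
            ≤ R / μ * B * S.intFactor s 0 * CE := by gcongr
          _ = R / μ * B * CE * S.intFactor s 0 := by ring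
          _ ≤ R / μ * B * CE * (B * tInt fun x => S.v s x * S.intFactor s x) := by gcongr
          _ = G * tInt (fun x => S.v s x * S.intFactor s x) := by rw [hG]; ring)
    have e0 : ∫ x in (-(1/2) : ℝ)..(1/2), S.v 0 x * S.intFactor 0 x = 1 := by
      simp only [Sol.intFactor, S.impulse_zero, neg_zero, zero_div, Real.exp_zero, mul_one]
      exact S.mean_v
    rw [e0, intervalIntegral.integral_zero, intervalIntegral.integral_const, smul_eq_mul,
      sub_zero, add_zero, mul_one] at hJ
    refine hJ.trans (Real.exp_le_exp.2 ?_)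
    rw [mul_comm]
    exact mul_le_mul_of_nonneg_left ht.2 hG0.le
  have F_le : ∀ t ∈ Icc 0 T, ∀ x, S.intFactor t x ≤ L := fun t ht x =>
    (factor_le_J t ht x).trans (mul_le_mul_of_nonneg_left (J_le t ht) hB0.le)
  have init : ∀ x, S.v 0 x * S.intFactor 0 x = S.v 0 x := fun x => by
    simp [Sol.intFactor, S.impulse_zero]
  have lower : ∀ t ∈ Icc 0 T, ∀ x, S.v 0 x ≤ S.v t x * S.intFactor t x := by
    intro t ht x
    have := sub_le_integral_of_hasDerivAt ht.1
      (fun s => (S.hasDerivAt_v_mul_intFactor s x).neg) (r := fun _ => 0) continuous_const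
      fun s hs => by
        rw [S.deriv_v_mul_intFactor hμ.ne' ⟨hs.1.le, hs.2.le.trans ht.2⟩]
        have := S.intFactor_pos s x
        have := S.θ_pos s x
        have : 0 < R / μ * S.θ s x * S.intFactor s x := by positivity
        linarith
    simp only [Pi.neg_apply, init, intervalIntegral.integral_zero] at this
    linarith
  have upper : ∀ t ∈ Icc 0 T, ∀ x, S.v t x * S.intFactor t x
      ≤ 1 + 3 * M ^ 2 + R / μ * B * L * Cθ * (T + CD) := by
    intro t ht x
    have cD := S.continuous_entropyProd
    have hB1 : 1 ≤ B := Real.one_le_exp (by positivity)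
    have h1 := sub_le_integral_of_hasDerivAt ht.1
      (fun s => S.hasDerivAt_v_mul_intFactor s x)
      (r := fun s => R / μ * B * L * Cθ * (1 + S.entropyProd s)) (by fun_prop)
      fun s hs => by
        have hs' : s ∈ Icc 0 T := ⟨hs.1.le, hs.2.le.trans ht.2⟩
        rw [S.deriv_v_mul_intFactor hμ.ne' hs']
        have h1 := (hθ S hS s hs' x).1
        have h2 := F_le s hs' x
        have h3 := S.θ_pos s x
        have h4 := S.intFactor_pos s x
        have h5 := S.entropyProd_nonneg s
        calc R / μ * S.θ s x * S.intFactor s x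
            ≤ R / μ * (Cθ * (1 + S.entropyProd s)) * L := by gcongr
          _ = R / μ * 1 * L * Cθ * (1 + S.entropyProd s) := by ring
          _ ≤ R / μ * B * L * Cθ * (1 + S.entropyProd s) := by gcongr
    simp only [init] at h1
    rw [intervalIntegral.integral_const_mul, intervalIntegral.integral_add
      intervalIntegrable_const (cD.intervalIntegrable _ _), intervalIntegral.integral_const,
      smul_eq_mul, sub_zero, mul_one] at h1
    have h2 := hD S hS t ht
    have h3 : S.v 0 x ^ 2 ≤ 3 * M ^ 2 :=
      (sq_le_of_H2sq_le (S.isSmooth_v.contDiff_space 0) (S.periodic_v 0)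
        (H2sq_initial_le hS).1 x).1
    have h4 : R / μ * B * L * Cθ * (t + ∫ s in (0 : ℝ)..t, S.entropyProd s)
        ≤ R / μ * B * L * Cθ * (T + CD) := by
      have := ht.2
      gcongr
    nlinarith [sq_nonneg (S.v 0 x - 1)]
  have F_ge : ∀ t ∈ Icc 0 T, ∀ x, 1 ≤ B * S.intFactor t x := by
    intro t ht x
    have cv0 := cv 0
    have cvt := cv t
    have : tInt (fun y => S.v 0 y) ≤ tInt fun y => B * S.intFactor t x * S.v t y := by
      refine tInt_mono (by fun_prop) (by fun_prop) fun y => (lower t ht y).trans ?_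
      have := mul_le_mul_of_nonneg_left (compare t ht y x) (S.v_pos t y).le
      linarith
    rw [tInt_const_mul] at this
    have e0 : tInt (fun y => S.v 0 y) = 1 := S.mean_v
    have e1 : tInt (fun y => S.v t y) = 1 := S.tInt_v ht
    rwa [e0, e1, mul_one] at this
  intro t ht x
  have hv := S.v_pos t x
  have hF := S.intFactor_pos t x
  constructor
  · rw [div_le_iff₀ (by positivity)]
    have hB1 : 1 ≤ B := Real.one_le_exp (by positivity)
    calc ε ≤ S.v t x * S.intFactor t x := (hS.2.1 x).trans (lower t ht x)
      _ ≤ S.v t x * (1 * L) := by rw [one_mul]; gcongr; exact F_le t ht x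
      _ ≤ S.v t x * (B * L) := by gcongr
  · have h1 := upper t ht x
    have h2 := F_ge t ht x
    have hB1 : 1 ≤ B := Real.one_le_exp (by positivity)
    calc S.v t x = S.v t x * 1 := by ring
      _ ≤ S.v t x * (B * S.intFactor t x) := by gcongr
      _ = B * 1 * (S.v t x * S.intFactor t x) := by ring
      _ ≤ B * B * (1 + 3 * M ^ 2 + R / μ * B * L * Cθ * (T + CD)) := by gcongr
      _ = _ := by ring

end RadHydro


namespace RadHydro

variable {μ R a b κ₁ κ₂ β γ T M ε : ℝ}

/-! ### Bounds for the velocity gradient and the temperature -/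

/-- The total viscous dissipation is bounded. -/
lemma exists_integral_px_u_le (h : Admissible μ R a b κ₁ κ₂ β γ T M ε) :
    ∃ C : ℝ, 0 < C ∧ ∀ S : Sol μ R a b κ₁ κ₂ β γ T, S.Bounded M ε → ∀ t ∈ Icc 0 T,
      ∫ s in (0 : ℝ)..t, L2sq (px S.u s) ≤ C := by
  obtain ⟨c, C, hc, hC, hv⟩ := exists_v_bounds h
  obtain ⟨CE, hCE, hE⟩ := exists_energy_le h
  obtain ⟨CD, hCD, hD⟩ := exists_integral_entropyProd_le h
  obtain ⟨Cθ, hCθ, hθ⟩ := exists_θ_le h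
  have hμ := h.μ_pos
  have hR := h.R_pos
  have hT := h.T_pos
  set K := R ^ 2 / (μ * c) * (CE * Cθ) with hK
  have hK0 : 0 < K := by positivity
  refine ⟨C / μ * (CE + K * (T + CD)), by positivity, fun S hS t ht => ?_⟩
  have cD := S.continuous_entropyProd
  have cg : Continuous fun s => L2sq (px S.u s) := (S.isSmooth_u.px.pow 2).continuous_tInt
  have key : ∀ s ∈ Icc 0 T, tInt (pt (fun s x => S.u s x ^ 2) s)
      ≤ K * (1 + S.entropyProd s) - μ / C * L2sq (px S.u s) := by
    intro s hs
    have cu := S.isSmooth_u.continuous_space s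
    have cpu := S.isSmooth_u.px.continuous_space s
    have cσ := S.isSmooth_stress.continuous_space s
    have cpσ := S.isSmooth_stress.px.continuous_space s
    have cθ := S.isSmooth_θ.continuous_space s
    have e0 : tInt (fun x => px S.u s x * S.stress s x + S.u s x * px S.stress s x) = 0 :=
      tInt_deriv_eq_zero ((S.periodic_u s).mul (S.periodic_stress s))
        (fun x => (S.isSmooth_u.hasDerivAt_px s x).mul (S.isSmooth_stress.hasDerivAt_px s x))
        (by fun_prop)
    rw [tInt_add (by fun_prop) (by fun_prop)] at e0
    have e1 : pt (fun s x => S.u s x ^ 2) s = fun x => 2 * (S.u s x * px S.stress s x) := by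
      funext x
      rw [← Sol.pt_u hs]
      exact ((S.isSmooth_u.hasDerivAt_pt s x).pow 2).deriv.trans (by simp; ring)
    have h1 : tInt (fun x => -2 * (px S.u s x * S.stress s x))
        ≤ tInt fun x => R ^ 2 / (μ * c) * (Cθ * (1 + S.entropyProd s)) * S.θ s x
          - μ / C * px S.u s x ^ 2 := by
      refine tInt_mono (by fun_prop) (by fun_prop) fun x => ?_
      have hv0 := S.v_pos s x
      have hθ0 := S.θ_pos s x
      have ev : -2 * (px S.u s x * S.stress s x) + μ / S.v s x * px S.u s x ^ 2
          = R ^ 2 / (μ * S.v s x) * S.θ s x ^ 2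
            - (μ * px S.u s x - R * S.θ s x) ^ 2 / (μ * S.v s x) := by
        simp only [Sol.stress, Sol.viscousStress, Sol.pressure]
        field_simp
        ring
      have h2 : μ / C * px S.u s x ^ 2 ≤ μ / S.v s x * px S.u s x ^ 2 := by
        have := (hv S hS s hs x).2
        gcongr
      have h3 : R ^ 2 / (μ * S.v s x) * S.θ s x ^ 2
          ≤ R ^ 2 / (μ * c) * (Cθ * (1 + S.entropyProd s)) * S.θ s x := by
        have h4 := (hv S hS s hs x).1
        have h5 := (hθ S hS s hs x).1
        calc R ^ 2 / (μ * S.v s x) * S.θ s x ^ 2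
            ≤ R ^ 2 / (μ * c) * S.θ s x ^ 2 := by gcongr
          _ = R ^ 2 / (μ * c) * S.θ s x * S.θ s x := by ring
          _ ≤ R ^ 2 / (μ * c) * (Cθ * (1 + S.entropyProd s)) * S.θ s x := by gcongr
      have h6 : 0 ≤ (μ * px S.u s x - R * S.θ s x) ^ 2 / (μ * S.v s x) := by positivity
      linarith
    rw [tInt_sub (by fun_prop) (by fun_prop), tInt_const_mul, tInt_const_mul,
      tInt_const_mul] at h1
    rw [e1, tInt_const_mul]
    have h2 : tInt (fun x => S.θ s x) ≤ CE := (hE S hS s hs).1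
    have h3 := S.entropyProd_nonneg s
    have h4 : R ^ 2 / (μ * c) * (Cθ * (1 + S.entropyProd s)) * tInt (fun x => S.θ s x)
        ≤ R ^ 2 / (μ * c) * (Cθ * (1 + S.entropyProd s)) * CE := by gcongr
    have h5 : R ^ 2 / (μ * c) * (Cθ * (1 + S.entropyProd s)) * CE
      = K * (1 + S.entropyProd s) := by rw [hK]; ring
    unfold L2sq
    linarith
  have h1 := sub_le_integral_of_hasDerivAt ht.1 (S.isSmooth_u.pow 2).hasDerivAt_tInt
    (r := fun s => K * (1 + S.entropyProd s) - μ / C * L2sq (px S.u s)) (by fun_prop)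
    fun s hs => key s ⟨hs.1.le, hs.2.le.trans ht.2⟩
  rw [intervalIntegral.integral_sub (Continuous.intervalIntegrable (by fun_prop) _ _)
    (Continuous.intervalIntegrable (by fun_prop) _ _), intervalIntegral.integral_const_mul,
    intervalIntegral.integral_const_mul, intervalIntegral.integral_add
      intervalIntegrable_const (cD.intervalIntegrable _ _), intervalIntegral.integral_const,
      smul_eq_mul, sub_zero, mul_one] at h1
  have h2 : 0 ≤ tInt (fun x => S.u t x ^ 2) := L2sq_nonneg _
  have h3 : tInt (fun x => S.u 0 x ^ 2) ≤ CE := (hE S hS 0 ⟨le_rfl, hT.le⟩).2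
  have h4 : K * (t + ∫ s in (0 : ℝ)..t, S.entropyProd s) ≤ K * (T + CD) := by
    have := ht.2
    have := hD S hS t ht
    gcongr
  have h5 : μ / C * (∫ s in (0 : ℝ)..t, L2sq (px S.u s)) ≤ CE + K * (T + CD) := by linarith
  calc ∫ s in (0 : ℝ)..t, L2sq (px S.u s)
      = C / μ * (μ / C * ∫ s in (0 : ℝ)..t, L2sq (px S.u s)) := by field_simp
    _ ≤ _ := by gcongr

/-- A pointwise bound for `u_x` in terms of the acceleration and a temperature bound. -/
lemma exists_px_u_sq_le (h : Admissible μ R a b κ₁ κ₂ β γ T M ε) :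
    ∃ C : ℝ, 0 < C ∧ ∀ S : Sol μ R a b κ₁ κ₂ β γ T, S.Bounded M ε → ∀ t ∈ Icc 0 T, ∀ B : ℝ,
      (∀ x, S.θ t x ^ 2 ≤ B) → ∀ x, px S.u t x ^ 2 ≤ C * (B + L2sq (pt S.u t)) := by
  obtain ⟨c, C, hc, hC, hv⟩ := exists_v_bounds h
  have hμ := h.μ_pos
  have hR := h.R_pos
  refine ⟨(C / μ) ^ 2 * (3 * (2 * R ^ 2 / c ^ 2) + 3), by positivity, fun S hS t ht B hB x => ?_⟩
  have cσ := S.isSmooth_stress.continuous_space t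
  have cpu := S.isSmooth_u.px.continuous_space t
  have cut := S.isSmooth_u.pt.continuous_space t
  obtain ⟨z, hz, ez⟩ := exists_mem_Icc_eq (S.periodic_px_u t) x
  rw [ez]
  obtain ⟨y, hy, hy'⟩ : ∃ y ∈ Icc (-(1/2) : ℝ) (1/2), px S.u t y = 0 := by
    obtain ⟨y, hy, e⟩ := exists_hasDerivAt_eq_zero (f := S.u t) (f' := px S.u t)
      (a := -(1/2)) (b := 1/2) (by norm_num)
      (S.isSmooth_u.continuous_space t).continuousOn (by
        have := S.periodic_u t (-(1/2))
        rw [← this]; norm_num) (fun x _ => S.isSmooth_u.hasDerivAt_px t x)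
    exact ⟨y, Ioo_subset_Icc_self hy, e⟩
  have h1 := abs_sub_le_tInt (S.isSmooth_stress.hasDerivAt_px t)
    (S.isSmooth_stress.px.continuous_space t) (g := fun x => |pt S.u t x|) (by fun_prop)
    (fun x => by rw [Sol.pt_u ht]) hz hy
  have h2 : tInt (fun x => |pt S.u t x|) ^ 2 ≤ L2sq (pt S.u t) := by
    have := sq_tInt_mul_le (f := fun x => |pt S.u t x|) (g := fun _ => 1) (by fun_prop)
      continuous_const
    simpa only [mul_one, one_pow, sq_abs, tInt_const, L2sq] using this
  have h3 : (S.stress t z - S.stress t y) ^ 2 ≤ L2sq (pt S.u t) := by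
    rw [← sq_abs]
    exact (pow_le_pow_left₀ (abs_nonneg _) h1 2).trans h2
  have hp : ∀ x, S.pressure t x ^ 2 ≤ R ^ 2 / c ^ 2 * B := by
    intro x
    have hvx := (hv S hS t ht x).1
    have hθ0 := S.θ_pos t x
    calc S.pressure t x ^ 2 = R ^ 2 / S.v t x ^ 2 * S.θ t x ^ 2 := by
          simp only [Sol.pressure]; ring
      _ ≤ R ^ 2 / c ^ 2 * B := by gcongr; exact hB x
  have h4 : S.viscousStress t z ^ 2
      ≤ 3 * (R ^ 2 / c ^ 2 * B) + 3 * (R ^ 2 / c ^ 2 * B) + 3 * L2sq (pt S.u t) := by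
    have e : S.viscousStress t z
        = (S.stress t z - S.stress t y) + S.pressure t z - S.pressure t y := by
      simp only [Sol.stress, Sol.viscousStress, hy']; ring
    have h5 := hp z
    have h6 := hp y
    rw [e]
    set d := S.stress t z - S.stress t y
    nlinarith [sq_nonneg (d - S.pressure t z), sq_nonneg (d + S.pressure t y),
      sq_nonneg (S.pressure t z + S.pressure t y)]
  have hvz := S.v_pos t z
  have h7 := (hv S hS t ht z).2
  have hL := L2sq_nonneg (pt S.u t)
  have hB0 : 0 ≤ B := (sq_nonneg _).trans (hB z)
  calc px S.u t z ^ 2 = (S.v t z / μ) ^ 2 * S.viscousStress t z ^ 2 := by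
        simp only [Sol.viscousStress]; field_simp
    _ ≤ (C / μ) ^ 2
        * (3 * (R ^ 2 / c ^ 2 * B) + 3 * (R ^ 2 / c ^ 2 * B) + 3 * L2sq (pt S.u t)) := by gcongr
    _ = (C / μ) ^ 2 * (3 * (2 * R ^ 2 / c ^ 2) * B + 3 * L2sq (pt S.u t)) := by ring
    _ ≤ (C / μ) ^ 2 * ((3 * (2 * R ^ 2 / c ^ 2) + 3) * (B + L2sq (pt S.u t))) := by
        gcongr
        have : 0 ≤ 3 * (2 * R ^ 2 / c ^ 2) := by positivity
        nlinarith [mul_nonneg this hL]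
    _ = _ := by ring

namespace Sol

variable (S : Sol μ R a b κ₁ κ₂ β γ T)

lemma isSmooth_Y_integrand : IsSmooth fun s x =>
    (kappa κ₁ κ₂ β (S.v s x) (S.θ s x)) ^ 2 * (px S.θ s x) ^ 2 / (S.v s x) ^ 2 :=
  ((S.isSmooth_kappa.pow 2).mul (S.isSmooth_θ.px.pow 2)).div (S.isSmooth_v.pow 2)
    fun t x => pow_pos (S.v_pos t x) 2

lemma isSmooth_X_integrand : IsSmooth fun s x =>
    kappa κ₁ κ₂ β (S.v s x) (S.θ s x) * (pt S.θ s x) ^ 2 / S.v s x :=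
  (S.isSmooth_kappa.mul (S.isSmooth_θ.pt.pow 2)).div S.isSmooth_v S.v_pos

lemma Y_nonneg (t : ℝ) : 0 ≤ S.Y t :=
  Real.sSup_nonneg fun _ ⟨_, _, e⟩ => e ▸ tInt_nonneg fun _ => by positivity

lemma Z_nonneg (t : ℝ) : 0 ≤ S.Z t :=
  Real.sSup_nonneg fun _ ⟨_, _, e⟩ => e ▸ tInt_nonneg fun _ => by positivity

lemma le_Y {s t : ℝ} (hs : s ∈ Icc 0 t) :
    tInt (fun x => (kappa κ₁ κ₂ β (S.v s x) (S.θ s x)) ^ 2 * (px S.θ s x) ^ 2 / (S.v s x) ^ 2)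
      ≤ S.Y t :=
  le_csSup (isCompact_Icc.bddAbove_image S.isSmooth_Y_integrand.continuous_tInt.continuousOn)
    (mem_image_of_mem _ hs)

end Sol

/-- The temperature is controlled by `𝔜`. -/
lemma exists_θ_sq_le (h : Admissible μ R a b κ₁ κ₂ β γ T M ε) :
    ∃ C : ℝ, 0 < C ∧ ∀ S : Sol μ R a b κ₁ κ₂ β γ T, S.Bounded M ε → ∀ t ∈ Icc 0 T,
      ∀ s ∈ Icc 0 t, ∀ x, S.θ s x ^ 2 ≤ C * (1 + S.Y t) := by
  obtain ⟨C, hC, hθ⟩ := exists_θ_le h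
  have hκ₁ := h.κ₁_pos
  have hκ₂ := h.κ₂_pos
  refine ⟨C * (1 + (κ₂ ^ 2)⁻¹), by positivity, fun S hS t ht s hs x => ?_⟩
  have h1 := (hθ S hS s ⟨hs.1, hs.2.trans ht.2⟩ x).2
  have h2 : κ₂ ^ 2 * tInt (fun x => S.θ s x ^ (2 * β) * px S.θ s x ^ 2) ≤ S.Y t := by
    refine le_trans ?_ (S.le_Y hs)
    rw [← tInt_const_mul]
    refine tInt_mono (((S.isSmooth_θ.rpow _ S.θ_pos).mul
      (S.isSmooth_θ.px.pow 2)).const_mul _ |>.continuous_space s)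
      (S.isSmooth_Y_integrand.continuous_space s) fun x => ?_
    have hv := S.v_pos s x
    have hr := Real.rpow_pos_of_pos (S.θ_pos s x) β
    have e : S.θ s x ^ (2 * β) = (S.θ s x ^ β) ^ 2 := by
      rw [mul_comm, Real.rpow_mul (S.θ_pos s x).le]; norm_num
    rw [le_div_iff₀ (by positivity), e]
    calc κ₂ ^ 2 * ((S.θ s x ^ β) ^ 2 * px S.θ s x ^ 2) * S.v s x ^ 2
        = (κ₂ * S.v s x * S.θ s x ^ β) ^ 2 * px S.θ s x ^ 2 := by ring
      _ ≤ _ := by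
        unfold kappa
        gcongr
        linarith
  have h3 : tInt (fun x => S.θ s x ^ (2 * β) * px S.θ s x ^ 2) ≤ (κ₂ ^ 2)⁻¹ * S.Y t := by
    rw [inv_mul_eq_div, le_div_iff₀ (by positivity)]; linarith
  have hY := S.Y_nonneg t
  have hκ : 0 < (κ₂ ^ 2)⁻¹ := by positivity
  calc S.θ s x ^ 2 ≤ C * (1 + (κ₂ ^ 2)⁻¹ * S.Y t) := h1.trans (by gcongr)
    _ ≤ C * ((1 + (κ₂ ^ 2)⁻¹) * (1 + S.Y t)) := by gcongr; nlinarith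
    _ = _ := by ring

end RadHydro

namespace RadHydro

variable {μ R a b κ₁ κ₂ β γ T M ε : ℝ}

/-! ### The estimate for the acceleration -/

namespace Sol

variable {S : Sol μ R a b κ₁ κ₂ β γ T}

lemma pt_pt_u {t : ℝ} (ht : t ∈ Ioo 0 T) (x : ℝ) : pt (pt S.u) t x = px (pt S.stress) t x := by
  rw [S.isSmooth_stress.px_pt]
  refine Filter.EventuallyEq.deriv_eq ?_
  filter_upwards [Ioo_mem_nhds ht.1 ht.2] with s hs
  exact pt_u ⟨hs.1.le, hs.2.le⟩ x

lemma pt_stress {t : ℝ} (ht : t ∈ Icc 0 T) (x : ℝ) :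
    pt S.stress t x = μ * (px (pt S.u) t x / S.v t x - px S.u t x ^ 2 / S.v t x ^ 2)
      - R * (pt S.θ t x / S.v t x - S.θ t x * px S.u t x / S.v t x ^ 2) := by
  have hv := (S.v_pos t x).ne'
  refine ((((S.isSmooth_u.px.hasDerivAt_pt t x).const_mul μ).div
    (S.isSmooth_v.hasDerivAt_pt t x) hv).sub
    (((S.isSmooth_θ.hasDerivAt_pt t x).const_mul R).div
    (S.isSmooth_v.hasDerivAt_pt t x) hv)).deriv.trans ?_
  rw [pt_v ht, S.isSmooth_u.px_pt]
  field_simp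

lemma periodic_pt_u (t : ℝ) : Function.Periodic (pt S.u t) 1 := fun x => by
  simp only [pt, S.periodic_u _ x]

lemma periodic_pt_stress (t : ℝ) : Function.Periodic (pt S.stress t) 1 := fun x => by
  simp only [pt, S.periodic_stress _ x]

lemma tInt_pt_sq_pt_u {t : ℝ} (ht : t ∈ Ioo 0 T) :
    tInt (pt (fun s x => pt S.u s x ^ 2) t)
      = tInt fun x => -2 * (px (pt S.u) t x * pt S.stress t x) := by
  have c1 := S.isSmooth_u.pt.continuous_space t
  have c2 := S.isSmooth_u.pt.px.continuous_space t
  have c3 := S.isSmooth_stress.pt.continuous_space t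
  have c4 := S.isSmooth_stress.pt.px.continuous_space t
  have e0 : tInt (fun x => px (pt S.u) t x * pt S.stress t x
      + pt S.u t x * px (pt S.stress) t x) = 0 :=
    tInt_deriv_eq_zero ((periodic_pt_u t).mul (periodic_pt_stress t))
      (fun x => (S.isSmooth_u.pt.hasDerivAt_px t x).mul (S.isSmooth_stress.pt.hasDerivAt_px t x))
      (by fun_prop)
  rw [tInt_add (by fun_prop) (by fun_prop)] at e0
  have e1 : pt (fun s x => pt S.u s x ^ 2) t
      = fun x => 2 * (pt S.u t x * px (pt S.stress) t x) := by
    funext x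
    rw [← pt_pt_u ht]
    exact ((S.isSmooth_u.pt.hasDerivAt_pt t x).pow 2).deriv.trans (by simp; ring)
  rw [e1, tInt_const_mul, tInt_const_mul]
  linarith

variable (S) in
lemma isSmooth_dissipation : IsSmooth fun s x => px (pt S.u) s x ^ 2 / S.v s x :=
  (S.isSmooth_u.pt.px.pow 2).div S.isSmooth_v S.v_pos

end Sol

/-- The differential inequality for `‖u_t‖²`. -/
lemma exists_deriv_L2sq_pt_u_le (h : Admissible μ R a b κ₁ κ₂ β γ T M ε) :
    ∃ C : ℝ, 0 < C ∧ ∀ S : Sol μ R a b κ₁ κ₂ β γ T, S.Bounded M ε → ∀ t ∈ Ioo 0 T, ∀ B : ℝ,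
      (∀ x, S.θ t x ^ 2 ≤ B) →
        tInt (pt (fun s x => pt S.u s x ^ 2) t)
          + μ * tInt (fun x => px (pt S.u) t x ^ 2 / S.v t x)
        ≤ C * tInt (fun x => kappa κ₁ κ₂ β (S.v t x) (S.θ t x) * (pt S.θ t x) ^ 2 / S.v t x)
          + C * (B + L2sq (pt S.u t)) * L2sq (px S.u t) := by
  obtain ⟨c, _, hc, _, hv⟩ := exists_v_bounds h
  obtain ⟨Cp, hCp, hp⟩ := exists_px_u_sq_le h
  have hμ := h.μ_pos
  have hR := h.R_pos
  have hκ₁ := h.κ₁_pos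
  have hκ₂ := h.κ₂_pos
  set K₁ := 3 * R ^ 2 / (μ * κ₁) with hK₁
  set K₂ := 3 * (μ ^ 2 * Cp + R ^ 2) / (μ * c ^ 3) with hK₂
  have hK₁0 : 0 < K₁ := by positivity
  have hK₂0 : 0 < K₂ := by positivity
  refine ⟨K₁ + K₂, by positivity, fun S hS t ht B hB => ?_⟩
  have ht' : t ∈ Icc 0 T := Ioo_subset_Icc_self ht
  have c1 := S.isSmooth_u.pt.px.continuous_space t
  have c2 := S.isSmooth_stress.pt.continuous_space t
  have c3 := S.isSmooth_u.px.continuous_space t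
  have c4 := S.isSmooth_dissipation.continuous_space t
  have c5 := S.isSmooth_X_integrand.continuous_space t
  have hL := L2sq_nonneg (pt S.u t)
  have hB0 : 0 ≤ B := (sq_nonneg _).trans (hB 0)
  rw [Sol.tInt_pt_sq_pt_u ht, ← tInt_const_mul μ, ← tInt_add (by fun_prop) (by fun_prop)]
  have key : tInt (fun x => -2 * (px (pt S.u) t x * pt S.stress t x)
        + μ * (px (pt S.u) t x ^ 2 / S.v t x))
      ≤ tInt fun x =>
        K₁ * (kappa κ₁ κ₂ β (S.v t x) (S.θ t x) * (pt S.θ t x) ^ 2 / S.v t x)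
          + K₂ * (B + L2sq (pt S.u t)) * px S.u t x ^ 2 := by
    refine tInt_mono (by fun_prop) (by fun_prop) fun x => ?_
    have hvx := S.v_pos t x
    have hcv := (hv S hS t ht' x).1
    have hpx := hp S hS t ht' B hB x
    have hθx := hB x
    have hr := Real.rpow_pos_of_pos (S.θ_pos t x) β
    rw [Sol.pt_stress ht']
    have h1 : K₁ * κ₁ * pt S.θ t x ^ 2 / S.v t x
        ≤ K₁ * (kappa κ₁ κ₂ β (S.v t x) (S.θ t x) * (pt S.θ t x) ^ 2 / S.v t x) := by
      rw [mul_assoc, mul_div_assoc]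
      gcongr
      unfold kappa
      have : 0 < κ₂ * S.v t x * S.θ t x ^ β := by positivity
      linarith
    have h2 : 3 / (μ * S.v t x ^ 3) * (μ ^ 2 * px S.u t x ^ 2 + R ^ 2 * S.θ t x ^ 2)
          * px S.u t x ^ 2
        ≤ K₂ * (B + L2sq (pt S.u t)) * px S.u t x ^ 2 := by
      refine mul_le_mul_of_nonneg_right ?_ (sq_nonneg _)
      calc 3 / (μ * S.v t x ^ 3) * (μ ^ 2 * px S.u t x ^ 2 + R ^ 2 * S.θ t x ^ 2)
          ≤ 3 / (μ * c ^ 3) * (μ ^ 2 * (Cp * (B + L2sq (pt S.u t)))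
            + R ^ 2 * (B + L2sq (pt S.u t))) := by
            gcongr
            linarith
        _ = K₂ * (B + L2sq (pt S.u t)) := by rw [hK₂]; ring
    refine le_trans ?_ (add_le_add h1 h2)
    rw [hK₁]
    generalize px (pt S.u) t x = w
    generalize px S.u t x = p at *
    generalize pt S.θ t x = τ
    generalize S.θ t x = θ at *
    generalize S.v t x = v at *
    have e : -2 * (w * (μ * (w / v - p ^ 2 / v ^ 2) - R * (τ / v - θ * p / v ^ 2)))
        + μ * (w ^ 2 / v)
        = (μ * p ^ 2 / v + R * τ - R * θ * p / v) ^ 2 / (μ * v)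
          - (μ * w - (μ * p ^ 2 / v + R * τ - R * θ * p / v)) ^ 2 / (μ * v) := by
      field_simp
      ring
    have e' : 3 * R ^ 2 / (μ * κ₁) * κ₁ * τ ^ 2 / v
          + 3 / (μ * v ^ 3) * (μ ^ 2 * p ^ 2 + R ^ 2 * θ ^ 2) * p ^ 2
        = (3 * (μ * p ^ 2 / v) ^ 2 + 3 * (R * τ) ^ 2 + 3 * (R * θ * p / v) ^ 2) / (μ * v) := by
      field_simp
      ring
    rw [e, e', sub_le_iff_le_add, ← add_div]
    gcongr
    generalize μ * p ^ 2 / v = X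
    generalize R * τ = Y
    generalize R * θ * p / v = Z
    nlinarith [sq_nonneg (X - Y), sq_nonneg (X + Z), sq_nonneg (Y + Z),
      sq_nonneg (μ * w - (X + Y - Z))]
  refine key.trans ?_
  rw [tInt_add (by fun_prop) (by fun_prop), tInt_const_mul, tInt_const_mul]
  have h1 : 0 ≤ tInt fun x =>
      kappa κ₁ κ₂ β (S.v t x) (S.θ t x) * (pt S.θ t x) ^ 2 / S.v t x :=
    tInt_nonneg fun x => by
      have := S.v_pos t x
      have := Real.rpow_pos_of_pos (S.θ_pos t x) β
      unfold kappa
      positivity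
  have h2 : 0 ≤ (B + L2sq (pt S.u t)) * L2sq (px S.u t) :=
    mul_nonneg (add_nonneg hB0 hL) (L2sq_nonneg _)
  have h3 := mul_nonneg hK₂0.le h1
  have h4 := mul_nonneg hK₁0.le h2
  unfold L2sq at *
  linarith

/-- The acceleration estimate in terms of `𝔛` and `𝔜`. -/
lemma exists_L2sq_pt_u_add_integral_le (h : Admissible μ R a b κ₁ κ₂ β γ T M ε) :
    ∃ C : ℝ, 0 < C ∧ ∀ S : Sol μ R a b κ₁ κ₂ β γ T, S.Bounded M ε → ∀ t ∈ Icc 0 T,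
      L2sq (pt S.u t) + (∫ s in (0 : ℝ)..t, tInt fun x => (px (pt S.u) s x) ^ 2 / S.v s x)
        ≤ C * (1 + S.X t + S.Y t) := by
  obtain ⟨K, hK, hd⟩ := exists_deriv_L2sq_pt_u_le h
  obtain ⟨C₀, hC₀, h0⟩ := exists_L2sq_pt_u_zero_le h
  obtain ⟨Cg, hCg, hg⟩ := exists_integral_px_u_le h
  obtain ⟨Cθ, hCθ, hθ⟩ := exists_θ_sq_le h
  have hμ := h.μ_pos
  have hκ₁ := h.κ₁_pos
  have hκ₂ := h.κ₂_pos
  refine ⟨(1 + μ⁻¹) * (Real.exp (K * Cg) * (C₀ + K + K * Cθ * Cg)), by positivity,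
    fun S hS t ht => ?_⟩
  set D : ℝ → ℝ := fun s => tInt fun x => (px (pt S.u) s x) ^ 2 / S.v s x with hD
  set H : ℝ → ℝ := fun s => tInt fun x =>
    kappa κ₁ κ₂ β (S.v s x) (S.θ s x) * (pt S.θ s x) ^ 2 / S.v s x with hH
  set g : ℝ → ℝ := fun s => L2sq (px S.u s) with hg'
  set B := Cθ * (1 + S.Y t) with hB
  have cD : Continuous D := S.isSmooth_dissipation.continuous_tInt
  have cH : Continuous H := S.isSmooth_X_integrand.continuous_tInt
  have cg : Continuous g := (S.isSmooth_u.px.pow 2).continuous_tInt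
  have hD0 : ∀ s, 0 ≤ D s := fun s => tInt_nonneg fun x => by
    have := S.v_pos s x
    positivity
  have hH0 : ∀ s, 0 ≤ H s := fun s => tInt_nonneg fun x => by
    have := S.v_pos s x
    have := Real.rpow_pos_of_pos (S.θ_pos s x) β
    unfold kappa
    positivity
  have hg0 : ∀ s, 0 ≤ g s := fun s => L2sq_nonneg _
  have hY := S.Y_nonneg t
  have hB0 : 0 ≤ B := by positivity
  have hID : ∀ s, 0 ≤ s → 0 ≤ ∫ z in (0 : ℝ)..s, D z := fun s hs =>
    intervalIntegral.integral_nonneg hs fun z _ => hD0 z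
  have hX : 0 ≤ S.X t := intervalIntegral.integral_nonneg ht.1 fun z _ => hH0 z
  have hF : ∀ s, HasDerivAt (fun s => L2sq (pt S.u s) + μ * ∫ z in (0 : ℝ)..s, D z)
      (tInt (pt (fun s x => pt S.u s x ^ 2) s) + μ * D s) s := fun s =>
    ((S.isSmooth_u.pt.pow 2).hasDerivAt_tInt s).add
      ((intervalIntegral.integral_hasDerivAt_right (cD.intervalIntegrable _ _)
        cD.aestronglyMeasurable.stronglyMeasurableAtFilter cD.continuousAt).const_mul μ)
  have main := le_exp_mul_of_deriv_le ht.1 hF (r := fun s => K * H s + K * B * g s)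
    (g := fun s => K * g s) (by fun_prop) (by fun_prop)
    (fun s => by have := hH0 s; have := hg0 s; positivity)
    (fun s => by have := hg0 s; positivity)
    (fun s hs => by
      have h1 := hd S hS s ⟨hs.1, hs.2.trans_le ht.2⟩ B (hθ S hS t ht s ⟨hs.1.le, hs.2.le⟩)
      have h2 : 0 ≤ K * g s * (μ * ∫ z in (0 : ℝ)..s, D z) :=
        mul_nonneg (mul_nonneg hK.le (hg0 s)) (mul_nonneg hμ.le (hID s hs.1.le))
      simp only [hD, hH, hg'] at h1 h2 ⊢
      linarith)
  simp only [intervalIntegral.integral_same, mul_zero, add_zero] at main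
  rw [intervalIntegral.integral_add (Continuous.intervalIntegrable (by fun_prop) _ _)
    (Continuous.intervalIntegrable (by fun_prop) _ _), intervalIntegral.integral_const_mul,
    intervalIntegral.integral_const_mul, intervalIntegral.integral_const_mul] at main
  have eX : ∫ s in (0 : ℝ)..t, H s = S.X t := rfl
  have hgt : ∫ s in (0 : ℝ)..t, g s ≤ Cg := hg S hS t ht
  have h0' := h0 S hS
  have hL0 := L2sq_nonneg (pt S.u 0)
  have hg0' : 0 ≤ ∫ s in (0 : ℝ)..t, g s :=
    intervalIntegral.integral_nonneg ht.1 fun z _ => hg0 z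
  rw [eX] at main
  have h1 : Real.exp (K * ∫ s in (0 : ℝ)..t, g s)
        * (L2sq (pt S.u 0) + (K * S.X t + K * B * ∫ s in (0 : ℝ)..t, g s))
      ≤ Real.exp (K * Cg) * ((C₀ + K + K * Cθ * Cg) * (1 + S.X t + S.Y t)) := by
    have h2 : L2sq (pt S.u 0) + (K * S.X t + K * B * ∫ s in (0 : ℝ)..t, g s)
        ≤ C₀ + (K * S.X t + K * B * Cg) := by gcongr
    have h3 : C₀ + (K * S.X t + K * B * Cg)
        ≤ (C₀ + K + K * Cθ * Cg) * (1 + S.X t + S.Y t) := by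
      have e : (C₀ + K + K * Cθ * Cg) * (1 + S.X t + S.Y t) - (C₀ + (K * S.X t + K * B * Cg))
          = C₀ * (S.X t + S.Y t) + K * (1 + S.Y t) + K * Cθ * Cg * S.X t := by
        rw [hB]; ring
      have : 0 ≤ C₀ * (S.X t + S.Y t) + K * (1 + S.Y t) + K * Cθ * Cg * S.X t := by positivity
      linarith
    gcongr
    exact h2.trans h3
  have h2 := main.trans h1
  have h3 := L2sq_nonneg (pt S.u t)
  have h4 := hID t ht.1
  calc L2sq (pt S.u t) + ∫ s in (0 : ℝ)..t, D s
      ≤ (1 + μ⁻¹) * (L2sq (pt S.u t) + μ * ∫ s in (0 : ℝ)..t, D s) := by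
        have e : (1 + μ⁻¹) * (L2sq (pt S.u t) + μ * ∫ s in (0 : ℝ)..t, D s)
            = L2sq (pt S.u t) + (∫ s in (0 : ℝ)..t, D s)
              + (μ⁻¹ * L2sq (pt S.u t) + μ * ∫ s in (0 : ℝ)..t, D s) := by
          field_simp
          ring
        have : 0 ≤ μ⁻¹ * L2sq (pt S.u t) + μ * ∫ s in (0 : ℝ)..t, D s := by positivity
        linarith
    _ ≤ (1 + μ⁻¹)
        * (Real.exp (K * Cg) * ((C₀ + K + K * Cθ * Cg) * (1 + S.X t + S.Y t))) := by gcongr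
    _ = _ := by ring

end RadHydro

theorem stmt_13 (μ R a b κ₁ κ₂ β γ : ℝ)
    (hμ : 0 < μ) (hR : 0 < R) (ha : 0 < a) (hb : 0 < b)
    (hκ₁ : 0 < κ₁) (hκ₂ : 0 < κ₂) (hβ : 0 < β) (hγ : 1 < γ)
    (T M ε : ℝ) (hT : 0 < T) (hM : 1 ≤ M) (hε0 : 0 < ε) (hε1 : ε ≤ 1)
    (n : ℝ) (hn : 8 ≤ n) :
    ∃ C : ℝ, 0 < C ∧
      ∀ S : Sol μ R a b κ₁ κ₂ β γ T, S.Bounded M ε →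
        ∀ t ∈ Icc (0 : ℝ) T,
          L2sq (pt S.u t) + (∫ s in (0 : ℝ)..t, tInt fun x => (px (pt S.u) s x) ^ 2 / S.v s x)
            ≤ S.Z t ^ Uz11 n β + C * (1 + S.X t + S.Y t + S.Y t ^ Uy11 n β) := by
  obtain ⟨C, hC, h⟩ := exists_L2sq_pt_u_add_integral_le
    (⟨hμ, hR, ha, hb, hκ₁, hκ₂, hβ, hγ, hT, hM, hε0, hε1⟩ :
      Admissible μ R a b κ₁ κ₂ β γ T M ε)
  refine ⟨C, hC, fun S hS t ht => (h S hS t ht).trans ?_⟩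
  have h1 := Real.rpow_nonneg (S.Z_nonneg t) (Uz11 n β)
  have h2 := mul_nonneg hC.le (Real.rpow_nonneg (S.Y_nonneg t) (Uy11 n β))
  linarith
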